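/- Let d ≥ 2, A > 0 and f ∈ C^{0,1}([0,A]) be non-increasing on [0,f₀] for some f₀ ∈ (0,A]. Then every continuous viscosity solution u of Ψ(−Δ)u = f(u) in ℝ^d∖{0} with u(0) = A, 0 ≤ u ≤ A on ℝ^d and lim_{|x|→∞} u(x) = 0 is radially symmetric and strictly decreasing in the radial direction. -/

import Mathlib

open MeasureTheory Set Filter Metric Asymptotics
open scoped RealInnerProductSpace ENNReal Topology NNReal

noncomputable section

abbrev Rd (d : ℕ) := EuclideanSpace ℝ (Fin d)

/-- The data of a Bernstein function `Ψ` vanishing at `0`, its Lévy measure `𝔪`,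
and the weak scaling conditions. -/
structure PsiSetting (d : ℕ) where
  Ψ : ℝ → ℝ
  m : Measure ℝ
  m_onIoi : m (Set.Iic 0) = 0
  smooth : ContDiffOn ℝ (⊤ : ℕ∞) Ψ (Set.Ioi 0)
  nonneg : ∀ x > (0:ℝ), 0 ≤ Ψ x
  deriv_alt : ∀ n : ℕ, ∀ x > (0:ℝ),
    (-1 : ℝ) ^ (n + 1) * iteratedDerivWithin (n + 1) Ψ (Set.Ioi 0) x ≤ 0
  zero_lim : Filter.Tendsto Ψ (nhdsWithin 0 (Set.Ioi 0)) (nhds 0)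
  levy_rep : ∀ lam > (0:ℝ), Ψ lam = ∫ t, (1 - Real.exp (-lam * t)) ∂m
  a₁ : ℝ
  a₂ : ℝ
  b₁ : ℝ
  b₂ : ℝ
  ha₁ : 0 < a₁
  ha₁₂ : a₁ ≤ a₂
  ha₂ : a₂ < 1
  hb₁ : 1 ≤ b₁
  hb₂ : 1 < b₂
  scaling_lower : ∀ r R : ℝ, 1 ≤ r → r ≤ R → (1 / b₁) * (R / r) ^ a₁ ≤ Ψ R / Ψ r
  scaling_upper : ∀ r R : ℝ, 1 ≤ r → r ≤ R → Ψ R / Ψ r ≤ b₁ * (R / r) ^ a₂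

/-- The jump kernel `j(r) = ∫_0^∞ (4πt)^{-d/2} e^{-r²/(4t)} 𝔪(dt)`. -/
def PsiSetting.j {d : ℕ} (S : PsiSetting d) (r : ℝ) : ℝ :=
  ∫ t, (4 * Real.pi * t) ^ (-(d : ℝ) / 2) * Real.exp (-(r ^ 2) / (4 * t)) ∂S.m

/-- The condition `j(r) ≤ b₂ j(r+1)` for `r ≥ 1`. -/
def PsiSetting.kernelCond {d : ℕ} (S : PsiSetting d) : Prop :=
  ∀ r : ℝ, 1 ≤ r → S.j r ≤ S.b₂ * S.j (r + 1)

/-- The nonlocal operator `Ψ(−Δ)` applied to a test function. -/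
def psiOp {d : ℕ} (S : PsiSetting d) (φ : Rd d → ℝ) (x : Rd d) : ℝ :=
  ∫ z : Rd d,
    (φ x - φ (x + z) + (if ‖z‖ ≤ 1 then ⟪z, gradient φ x⟫ else 0)) * S.j ‖z‖

/-- Admissible test functions at `x`: bounded continuous and C² near `x`. -/
def TestAt {d : ℕ} (x : Rd d) (φ : Rd d → ℝ) : Prop :=
  (∃ M, ∀ y, |φ y| ≤ M) ∧ Continuous φ ∧ ∃ U ∈ nhds x, ContDiffOn ℝ 2 φ U

/-- Viscosity supersolution of `Ψ(−Δ)u + c·u = g` in `Ω`. -/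
def IsSuperSol {d : ℕ} (S : PsiSetting d) (Ω : Set (Rd d)) (c g u : Rd d → ℝ) : Prop :=
  LowerSemicontinuous u ∧
    ∀ x ∈ Ω, ∀ φ : Rd d → ℝ, TestAt x φ → φ x = u x → (∀ y, y ≠ x → φ y < u y) →
      g x ≤ psiOp S φ x + c x * u x

/-- Viscosity subsolution of `Ψ(−Δ)u + c·u = g` in `Ω`. -/
def IsSubSol {d : ℕ} (S : PsiSetting d) (Ω : Set (Rd d)) (c g u : Rd d → ℝ) : Prop :=
  UpperSemicontinuous u ∧
    ∀ x ∈ Ω, ∀ φ : Rd d → ℝ, TestAt x φ → φ x = u x → (∀ y, y ≠ x → u y < φ y) →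
      psiOp S φ x + c x * u x ≤ g x

/-- Viscosity solution of `Ψ(−Δ)u + c·u = g` in `Ω`. -/
def IsSol {d : ℕ} (S : PsiSetting d) (Ω : Set (Rd d)) (c g u : Rd d → ℝ) : Prop :=
  IsSubSol S Ω c g u ∧ IsSuperSol S Ω c g u

/-- `V` is the renewal function of the ascending ladder-height process associated with `Ψ`. -/
structure IsRenewal (Ψ V : ℝ → ℝ) : Prop where
  nonneg : ∀ x, 0 ≤ V x
  zero : ∀ x ≤ (0:ℝ), V x = 0
  cont : ContinuousOn V (Set.Ioi 0)
  mono : StrictMonoOn V (Set.Ioi 0)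
  laplace : ∀ s : ℝ, 0 < s →
    (∫ x in Set.Ioi (0 : ℝ), V x * Real.exp (-s * x)) =
      1 / (s * Real.exp ((1 / Real.pi) *
        ∫ y in Set.Ioi (0 : ℝ), Real.log (Ψ (s * y)) / (1 + y ^ 2)))

/-- `tr_V(u)(x) = t`: the `V`-trace of `u` at the boundary point `x` of `D`. -/
def HasVTrace {d : ℕ} (V : ℝ → ℝ) (D : Set (Rd d)) (u : Rd d → ℝ)
    (x : Rd d) (t : ℝ) : Prop :=
  Filter.Tendsto (fun z => u z / V (Metric.infDist z Dᶜ)) (nhdsWithin x D) (nhds t)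

/-- An open set has C² boundary. -/
def HasC2Boundary {d : ℕ} (D : Set (Rd d)) : Prop :=
  ∀ x ∈ frontier D, ∃ (U : Set (Rd d)) (f : Rd d → ℝ),
    IsOpen U ∧ x ∈ U ∧ ContDiffOn ℝ 2 f U ∧ (∀ y ∈ U, fderiv ℝ f y ≠ 0) ∧
      D ∩ U = {y ∈ U | f y < 0}

/-- A closed set has C² boundary. -/
def HasC2BoundaryClosed {d : ℕ} (G : Set (Rd d)) : Prop :=
  ∀ x ∈ frontier G, ∃ (U : Set (Rd d)) (f : Rd d → ℝ),
    IsOpen U ∧ x ∈ U ∧ ContDiffOn ℝ 2 f U ∧ (∀ y ∈ U, fderiv ℝ f y ≠ 0) ∧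
      G ∩ U = {y ∈ U | f y ≤ 0}

/-- Reflection `R_{λ,e}` across the hyperplane `{x·e = λ}`. -/
def reflAt {d : ℕ} (e : Rd d) (lam : ℝ) (x : Rd d) : Rd d :=
  x - (2 * ⟪x, e⟫ - 2 * lam) • e

/-- The open half-space `H_{λ,e} = {x·e > λ}`. -/
def halfSpace {d : ℕ} (e : Rd d) (lam : ℝ) : Set (Rd d) := {x | lam < ⟪x, e⟫}

/-- A function is antisymmetric with respect to the half-space `H_{λ,e}`. -/
def AntiSym {d : ℕ} (e : Rd d) (lam : ℝ) (u : Rd d → ℝ) : Prop :=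
  ∀ x, u x = - u (reflAt e lam x)

section Kernel

variable {d : ℕ} (S : PsiSetting d)

/-- The heat kernel at time `t`, as a function of the radius. -/
def heatRadial (d : ℕ) (t r : ℝ) : ℝ :=
  (4 * Real.pi * t) ^ (-(d : ℝ) / 2) * Real.exp (-(r ^ 2) / (4 * t))

theorem PsiSetting.ae_pos : ∀ᵐ t ∂S.m, 0 < t := by
  rw [ae_iff]
  simpa [Set.Iic] using S.m_onIoi

theorem PsiSetting.Psi_pos {r : ℝ} (hr : 1 ≤ r) : 0 < S.Ψ r := by
  refine lt_of_le_of_ne (S.nonneg r (by linarith)) fun h => ?_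
  have := S.scaling_lower r r hr le_rfl
  rw [← h, div_zero, div_self (by linarith), Real.one_rpow] at this
  have hb := S.hb₁
  have : 0 < 1 / S.b₁ * 1 := by positivity
  linarith

theorem PsiSetting.integrable_one_sub_exp {r : ℝ} (hr : 1 ≤ r) :
    Integrable (fun t => 1 - Real.exp (-r * t)) S.m := by
  by_contra h
  have h1 := S.levy_rep r (by linarith)
  rw [integral_undef h] at h1
  exact (S.Psi_pos hr).ne' h1

theorem PsiSetting.sigmaFinite : SigmaFinite S.m := by
  obtain ⟨s, hs, h0, hfin⟩ :=
    (S.integrable_one_sub_exp le_rfl).aefinStronglyMeasurable.exists_set_sigmaFinite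
  have hsc : S.m sᶜ = 0 := by
    have hpos : ∀ᵐ t ∂S.m.restrict sᶜ, 0 < t := ae_restrict_of_ae S.ae_pos
    have : ∀ᵐ t ∂S.m.restrict sᶜ, False := by
      filter_upwards [h0, hpos] with t h1 h2
      have : Real.exp (-1 * t) < 1 := by
        rw [Real.exp_lt_one_iff]
        linarith
      simp only [Pi.zero_apply] at h1
      linarith
    rw [← Measure.restrict_apply_univ]
    simpa [ae_iff] using this
  rwa [Measure.restrict_eq_self_of_ae_mem (by rw [ae_iff]; exact hsc)] at hfin

theorem PsiSetting.measure_univ : S.m Set.univ = ∞ := by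
  by_contra h
  have hfin : IsFiniteMeasure S.m := ⟨lt_top_iff_ne_top.2 h⟩
  have hle : ∀ R : ℝ, 1 ≤ R → S.Ψ R ≤ S.m.real Set.univ := by
    intro R hR
    rw [S.levy_rep R (by linarith)]
    have : ∫ t, (1 - Real.exp (-R * t)) ∂S.m ≤ ∫ t, (1 : ℝ) ∂S.m := by
      refine integral_mono (S.integrable_one_sub_exp hR) (integrable_const _) fun t => ?_
      have := Real.exp_pos (-R * t)
      simp only
      linarith
    simpa using this
  have hb := S.hb₁
  have h1 := S.Psi_pos le_rfl
  have htend : Tendsto (fun R : ℝ => 1 / S.b₁ * R ^ S.a₁ * S.Ψ 1) atTop atTop :=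
    ((tendsto_rpow_atTop S.ha₁).const_mul_atTop (by positivity)).atTop_mul_const h1
  obtain ⟨R, hR, hR1⟩ := ((htend.eventually_gt_atTop (S.m.real Set.univ)).and
    (eventually_ge_atTop 1)).exists
  have h2 := S.scaling_lower 1 R le_rfl hR1
  rw [div_one, le_div_iff₀ h1] at h2
  linarith [hle R hR1]

theorem measurable_heatRadial (d : ℕ) :
    Measurable fun p : ℝ × ℝ => heatRadial d p.1 p.2 := by
  unfold heatRadial
  fun_prop

theorem heatRadial_pos {t : ℝ} (ht : 0 < t) (r : ℝ) : 0 < heatRadial d t r := by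
  have := Real.pi_pos
  unfold heatRadial
  positivity

theorem integrable_exp_neg_mul_norm_sq {b : ℝ} (hb : 0 < b) :
    Integrable fun z : Rd d => Real.exp (-b * ‖z‖ ^ 2) := by
  by_contra h
  have h1 := GaussianFourier.integral_rexp_neg_mul_sq_norm (V := Rd d) hb
  rw [integral_undef h] at h1
  have := Real.pi_pos
  have : 0 < (Real.pi / b) ^ ((Module.finrank ℝ (Rd d) : ℝ) / 2) := by positivity
  linarith

theorem integrable_heatRadial {t : ℝ} (ht : 0 < t) :
    Integrable fun z : Rd d => heatRadial d t ‖z‖ := by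
  have h := (integrable_exp_neg_mul_norm_sq (d := d) (b := 1 / (4 * t)) (by positivity)).const_mul
    ((4 * Real.pi * t) ^ (-(d : ℝ) / 2))
  refine h.congr (ae_of_all _ fun z => ?_)
  simp only [heatRadial]
  congr 2
  ring

theorem integral_heatRadial {t : ℝ} (ht : 0 < t) :
    ∫ z : Rd d, heatRadial d t ‖z‖ = 1 := by
  have h1 := GaussianFourier.integral_rexp_neg_mul_sq_norm (V := Rd d)
    (b := 1 / (4 * t)) (by positivity)
  have hpi := Real.pi_pos
  have : (fun z : Rd d => heatRadial d t ‖z‖) = fun z =>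
      (4 * Real.pi * t) ^ (-(d : ℝ) / 2) * Real.exp (-(1 / (4 * t)) * ‖z‖ ^ 2) := by
    ext z
    simp only [heatRadial]
    congr 2
    ring
  rw [this, integral_const_mul, h1, finrank_euclideanSpace_fin, neg_div,
    Real.rpow_neg (by positivity)]
  have h2 : Real.pi / (1 / (4 * t)) = 4 * Real.pi * t := by field_simp
  rw [h2]
  exact inv_mul_cancel₀ (by positivity)

theorem sq_mul_heatRadial_le {t : ℝ} (ht : 0 < t) (r : ℝ) :
    r ^ 2 * heatRadial d t r ≤ 8 * t * 2 ^ ((d : ℝ) / 2) * heatRadial d (2 * t) r := by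
  have hpi := Real.pi_pos
  have h1 : r ^ 2 / (8 * t) * Real.exp (-(r ^ 2) / (8 * t)) ≤ 1 := by
    have h := Real.add_one_le_exp (r ^ 2 / (8 * t))
    rw [neg_div, Real.exp_neg]
    rw [mul_inv_le_iff₀ (Real.exp_pos _)]
    linarith
  have h2 : Real.exp (-(r ^ 2) / (4 * t)) =
      Real.exp (-(r ^ 2) / (8 * t)) * Real.exp (-(r ^ 2) / (8 * t)) := by
    rw [← Real.exp_add]
    congr 1
    field_simp
    ring
  have h3 : (2 : ℝ) ^ ((d : ℝ) / 2) * (4 * Real.pi * (2 * t)) ^ (-(d : ℝ) / 2) =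
      (4 * Real.pi * t) ^ (-(d : ℝ) / 2) := by
    rw [show 4 * Real.pi * (2 * t) = 2 * (4 * Real.pi * t) by ring,
      Real.mul_rpow (by positivity) (by positivity), ← mul_assoc, ← Real.rpow_add (by positivity)]
    rw [show (d : ℝ) / 2 + -(d : ℝ) / 2 = 0 by ring, Real.rpow_zero, one_mul]
  unfold heatRadial
  rw [h2, show 4 * (2 * t) = 8 * t by ring]
  calc _ = (8 * t * (4 * Real.pi * t) ^ (-(d : ℝ) / 2) * Real.exp (-(r ^ 2) / (8 * t))) *
        (r ^ 2 / (8 * t) * Real.exp (-(r ^ 2) / (8 * t))) := by field_simp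
    _ ≤ (8 * t * (4 * Real.pi * t) ^ (-(d : ℝ) / 2) * Real.exp (-(r ^ 2) / (8 * t))) * 1 := by
        gcongr
    _ = _ := by rw [← h3, show 4 * Real.pi * (2 * t) = 4 * (2 * t) * Real.pi by ring]; ring

/-- The jump kernel as an `ℝ≥0∞`-valued integral. -/
def PsiSetting.lj (r : ℝ) : ℝ≥0∞ := ∫⁻ t, ENNReal.ofReal (heatRadial d t r) ∂S.m

theorem PsiSetting.j_eq_toReal (r : ℝ) : S.j r = (S.lj r).toReal := by
  refine integral_eq_lintegral_of_nonneg_ae ?_ ?_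
  · filter_upwards [S.ae_pos] with t ht using (heatRadial_pos ht r).le
  · exact ((measurable_heatRadial d).comp (measurable_id.prodMk measurable_const)).aestronglyMeasurable

theorem PsiSetting.j_nonneg (r : ℝ) : 0 ≤ S.j r := by
  rw [S.j_eq_toReal]
  exact ENNReal.toReal_nonneg

theorem PsiSetting.measurable_lj : Measurable S.lj := by
  have := S.sigmaFinite
  exact Measurable.lintegral_prod_right'
    (f := fun p : ℝ × ℝ => ENNReal.ofReal (heatRadial d p.2 p.1))
    (((measurable_heatRadial d).comp measurable_swap).ennreal_ofReal)

theorem PsiSetting.measurable_j : Measurable S.j := by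
  have : S.j = fun r => (S.lj r).toReal := funext S.j_eq_toReal
  rw [this]
  exact S.measurable_lj.ennreal_toReal

theorem PsiSetting.lintegral_mul_lj {g : ℝ → ℝ≥0∞} (hg : Measurable g) :
    ∫⁻ z : Rd d, g ‖z‖ * S.lj ‖z‖ =
      ∫⁻ t, (∫⁻ z : Rd d, g ‖z‖ * ENNReal.ofReal (heatRadial d t ‖z‖)) ∂S.m := by
  have := S.sigmaFinite
  have hm : Measurable (Function.uncurry fun (z : Rd d) (t : ℝ) =>
      g ‖z‖ * ENNReal.ofReal (heatRadial d t ‖z‖)) :=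
    (hg.comp (measurable_fst.norm)).mul
      (((measurable_heatRadial d).comp (measurable_snd.prodMk measurable_fst.norm)).ennreal_ofReal)
  rw [← lintegral_lintegral_swap hm.aemeasurable]
  refine lintegral_congr fun z => ?_
  rw [PsiSetting.lj, lintegral_const_mul]
  exact ((measurable_heatRadial d).comp (measurable_id.prodMk measurable_const)).ennreal_ofReal

theorem PsiSetting.lintegral_lj : ∫⁻ z : Rd d, S.lj ‖z‖ = ∞ := by
  have h := S.lintegral_mul_lj (g := 1) measurable_one
  simp only [Pi.one_apply, one_mul] at h
  rw [h, ← S.measure_univ, ← lintegral_one]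
  refine lintegral_congr_ae ?_
  filter_upwards [S.ae_pos] with t ht
  rw [← ofReal_integral_eq_lintegral_ofReal (integrable_heatRadial ht)
    (ae_of_all _ fun z => (heatRadial_pos ht _).le), integral_heatRadial ht]
  simp

theorem min_one_le_mul_one_sub_exp {t : ℝ} (ht : 0 < t) :
    min 1 t ≤ 2 * (1 - Real.exp (-1 * t)) := by
  have h2 : Real.exp (-1 * t) ≤ 1 / (1 + t) := by
    rw [neg_one_mul, Real.exp_neg, inv_eq_one_div]
    exact one_div_le_one_div_of_le (by linarith) (by linarith [Real.add_one_le_exp t])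
  have h3 : 1 - 1 / (1 + t) = t / (1 + t) := by field_simp; ring
  have h4 : min 1 t ≤ 2 * (t / (1 + t)) := by
    rw [← mul_div_assoc, le_div_iff₀ (by linarith)]
    rcases le_total t 1 with h | h
    · rw [min_eq_right h]; nlinarith
    · rw [min_eq_left h]; linarith
  linarith

theorem PsiSetting.lintegral_min_mul_lj :
    ∫⁻ z : Rd d, ENNReal.ofReal (min 1 (‖z‖ ^ 2)) * S.lj ‖z‖ < ∞ := by
  rw [S.lintegral_mul_lj (g := fun r => ENNReal.ofReal (min 1 (r ^ 2)))
    (by fun_prop)]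
  set C : ℝ := 2 * (1 + 8 * 2 ^ ((d : ℝ) / 2)) with hC
  have hC0 : 0 ≤ (2 : ℝ) ^ ((d : ℝ) / 2) := by positivity
  have hint := (S.integrable_one_sub_exp le_rfl).const_mul C
  refine lt_of_le_of_lt (lintegral_mono_ae ?_) hint.lintegral_lt_top
  filter_upwards [S.ae_pos] with t ht
  have hi1 := integrable_heatRadial (d := d) ht
  have hi2 := integrable_heatRadial (d := d) (t := 2 * t) (by linarith)
  have hint2 : Integrable fun z : Rd d => min 1 (‖z‖ ^ 2) * heatRadial d t ‖z‖ := by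
    refine hi1.mono ((by fun_prop : Continuous fun z : Rd d =>
      min 1 (‖z‖ ^ 2)).aestronglyMeasurable.mul hi1.aestronglyMeasurable) (ae_of_all _ fun z => ?_)
    rw [norm_mul]
    refine mul_le_of_le_one_left (norm_nonneg _) ?_
    rw [Real.norm_eq_abs, abs_le]
    exact ⟨by have : 0 ≤ min 1 (‖z‖ ^ 2) := by positivity
              linarith, min_le_left _ _⟩
  have hnn : ∀ z : Rd d, 0 ≤ min 1 (‖z‖ ^ 2) * heatRadial d t ‖z‖ := fun z =>
    mul_nonneg (by positivity) (heatRadial_pos ht _).le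
  have e1 : ∫ z : Rd d, min 1 (‖z‖ ^ 2) * heatRadial d t ‖z‖ ≤ 1 := by
    refine (integral_mono hint2 hi1 fun z => ?_).trans (integral_heatRadial ht).le
    exact mul_le_of_le_one_left (heatRadial_pos ht _).le (min_le_left _ _)
  have e2 : ∫ z : Rd d, min 1 (‖z‖ ^ 2) * heatRadial d t ‖z‖ ≤ 8 * t * 2 ^ ((d : ℝ) / 2) := by
    have := integral_heatRadial (d := d) (t := 2 * t) (by linarith)
    refine (integral_mono hint2 (hi2.const_mul (8 * t * 2 ^ ((d : ℝ) / 2))) fun z => ?_).trans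
      (by rw [integral_const_mul, this, mul_one])
    exact (mul_le_mul_of_nonneg_right (min_le_right _ _) (heatRadial_pos ht _).le).trans
      (sq_mul_heatRadial_le ht _)
  calc ∫⁻ z : Rd d, ENNReal.ofReal (min 1 (‖z‖ ^ 2)) * ENNReal.ofReal (heatRadial d t ‖z‖)
      = ∫⁻ z : Rd d, ENNReal.ofReal (min 1 (‖z‖ ^ 2) * heatRadial d t ‖z‖) :=
        lintegral_congr fun z => (ENNReal.ofReal_mul (by positivity)).symm
    _ = ENNReal.ofReal (∫ z : Rd d, min 1 (‖z‖ ^ 2) * heatRadial d t ‖z‖) :=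
        (ofReal_integral_eq_lintegral_ofReal hint2 (ae_of_all _ hnn)).symm
    _ ≤ ENNReal.ofReal (C * (1 - Real.exp (-1 * t))) := by
        refine ENNReal.ofReal_le_ofReal ?_
        have h5 := min_one_le_mul_one_sub_exp ht
        rw [hC]
        rcases le_total t 1 with h | h
        · rw [min_eq_right h] at h5
          nlinarith
        · rw [min_eq_left h] at h5
          nlinarith

theorem PsiSetting.lj_antitone : AntitoneOn S.lj (Set.Ici 0) := by
  intro r hr s _ hrs
  refine lintegral_mono_ae ?_
  filter_upwards [S.ae_pos] with t ht
  refine ENNReal.ofReal_le_ofReal ?_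
  have hpi := Real.pi_pos
  have hr : 0 ≤ r := hr
  unfold heatRadial
  gcongr

theorem PsiSetting.lj_lt_top (hd : 0 < d) {r : ℝ} (hr : 0 < r) : S.lj r < ∞ := by
  have : Nonempty (Fin d) := ⟨⟨0, hd⟩⟩
  have hm : Measurable fun z : Rd d => ENNReal.ofReal (min 1 (‖z‖ ^ 2)) * S.lj ‖z‖ :=
    (by fun_prop : Measurable fun z : Rd d => ENNReal.ofReal (min 1 (‖z‖ ^ 2))).mul
      (S.measurable_lj.comp measurable_norm)
  have h1 := ae_lt_top hm S.lintegral_min_mul_lj.ne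
  have hopen : IsOpen (ball (0 : Rd d) r \ {0}) := isOpen_ball.sdiff isClosed_singleton
  have hne : (ball (0 : Rd d) r \ {0}).Nonempty := by
    obtain ⟨e, he⟩ := exists_norm_eq (Rd d) (c := r / 2) (by positivity)
    refine ⟨e, by simp [he]; linarith [abs_of_pos hr], fun h => ?_⟩
    rw [mem_singleton_iff] at h
    rw [h, norm_zero] at he
    linarith
  have hpos := hopen.measure_pos volume hne
  obtain ⟨z, hz, hz1⟩ : ∃ z ∈ ball (0 : Rd d) r \ {0},
      ENNReal.ofReal (min 1 (‖z‖ ^ 2)) * S.lj ‖z‖ < ∞ := by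
    by_contra! hcon
    refine hpos.ne' (measure_mono_null (fun z hz => ?_) (ae_iff.1 h1))
    simpa using hcon z hz
  have hz0 : 0 < ‖z‖ := norm_pos_iff.2 hz.2
  have hzr : ‖z‖ < r := by simpa using hz.1
  refine lt_of_le_of_lt (S.lj_antitone hz0.le hr.le hzr.le) ?_
  by_contra! h
  rw [top_le_iff.1 h, ENNReal.mul_top] at hz1
  · exact lt_irrefl _ hz1
  · exact (ENNReal.ofReal_pos.2 (by positivity)).ne'

theorem PsiSetting.integrable_heatRadial_time (hd : 0 < d) {r : ℝ} (hr : 0 < r) :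
    Integrable (fun t => heatRadial d t r) S.m := by
  refine (lintegral_ofReal_ne_top_iff_integrable ?_ ?_).1 (S.lj_lt_top hd hr).ne
  · exact ((measurable_heatRadial d).comp (measurable_id.prodMk measurable_const)).aestronglyMeasurable
  · filter_upwards [S.ae_pos] with t ht using (heatRadial_pos ht r).le

theorem PsiSetting.m_ne_zero : S.m ≠ 0 := by
  intro h
  have := S.measure_univ
  simp [h] at this

theorem PsiSetting.j_strictAnti (hd : 0 < d) {r s : ℝ} (hr : 0 < r) (hrs : r < s) :
    S.j s < S.j r := by
  have hi1 := S.integrable_heatRadial_time hd hr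
  have hi2 := S.integrable_heatRadial_time hd (hr.trans hrs)
  have hlt : ∀ᵐ t ∂S.m, heatRadial d t s < heatRadial d t r := by
    filter_upwards [S.ae_pos] with t ht
    have hpi := Real.pi_pos
    unfold heatRadial
    gcongr
  have hlt' : 0 < ∫ t, (heatRadial d t r - heatRadial d t s) ∂S.m := by
    refine (integral_pos_iff_support_of_nonneg_ae ?_ (hi1.sub hi2)).2 ?_
    · filter_upwards [hlt] with t ht using (sub_pos.2 ht).le
    · rw [pos_iff_ne_zero]
      intro h0
      refine S.m_ne_zero (Measure.measure_univ_eq_zero.1 ?_)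
      refine measure_mono_null ?_ (measure_union_null h0 (ae_iff.1 hlt))
      intro t _
      by_cases ht : heatRadial d t s < heatRadial d t r
      · exact Or.inl (sub_pos.2 ht).ne'
      · exact Or.inr ht
  rw [integral_sub hi1 hi2] at hlt'
  exact sub_pos.1 hlt'

theorem PsiSetting.j_pos (hd : 0 < d) {r : ℝ} (hr : 0 < r) : 0 < S.j r :=
  (S.j_nonneg _).trans_lt (S.j_strictAnti hd hr (lt_add_one r))

theorem PsiSetting.ofReal_j (hd : 0 < d) {r : ℝ} (hr : 0 < r) :
    ENNReal.ofReal (S.j r) = S.lj r := by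
  rw [S.j_eq_toReal, ENNReal.ofReal_toReal (S.lj_lt_top hd hr).ne]

theorem PsiSetting.measurable_j_norm : Measurable fun z : Rd d => S.j ‖z‖ :=
  S.measurable_j.comp measurable_norm

theorem PsiSetting.integrable_min_mul_j :
    Integrable fun z : Rd d => min 1 (‖z‖ ^ 2) * S.j ‖z‖ := by
  refine ⟨((by fun_prop : Measurable fun z : Rd d => min 1 (‖z‖ ^ 2)).mul
    S.measurable_j_norm).aestronglyMeasurable, ?_⟩
  rw [hasFiniteIntegral_iff_ofReal
    (ae_of_all _ fun z => mul_nonneg (by positivity) (S.j_nonneg _))]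
  refine lt_of_le_of_lt (lintegral_mono fun z => ?_) S.lintegral_min_mul_lj
  rw [ENNReal.ofReal_mul (by positivity), S.j_eq_toReal]
  gcongr
  exact ENNReal.ofReal_toReal_le

/-- A bounded function that is quadratically small at the origin is integrable against the
jump kernel. -/
theorem PsiSetting.integrable_mul_j {F : Rd d → ℝ} (hF : AEStronglyMeasurable F volume)
    {C ρ : ℝ} (hρ : 0 < ρ) (hC : ∀ z, |F z| ≤ C) (hq : ∀ z, ‖z‖ < ρ → |F z| ≤ C * ‖z‖ ^ 2) :
    Integrable fun z => F z * S.j ‖z‖ := by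
  have hC0 : 0 ≤ C := (abs_nonneg _).trans (hC 0)
  refine (S.integrable_min_mul_j.const_mul (C * (1 + 1 / ρ ^ 2))).mono'
    (hF.mul S.measurable_j_norm.aestronglyMeasurable) (ae_of_all _ fun z => ?_)
  rw [norm_mul, Real.norm_eq_abs, Real.norm_eq_abs, abs_of_nonneg (S.j_nonneg _), ← mul_assoc]
  refine mul_le_mul_of_nonneg_right ?_ (S.j_nonneg _)
  have hpos : 0 ≤ 1 / ρ ^ 2 := by positivity
  rcases le_total 1 (‖z‖ ^ 2) with h | h
  · rw [min_eq_left h, mul_one]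
    nlinarith [hC z, mul_nonneg hC0 hpos]
  · rw [min_eq_right h]
    rcases lt_or_ge ‖z‖ ρ with hz | hz
    · nlinarith [hq z hz, mul_nonneg (mul_nonneg hC0 hpos) (sq_nonneg ‖z‖)]
    · have h1 : 1 ≤ 1 / ρ ^ 2 * ‖z‖ ^ 2 := by
        rw [one_div_mul_eq_div, one_le_div (by positivity)]
        gcongr
      nlinarith [hC z, mul_le_mul_of_nonneg_left h1 hC0, mul_nonneg hC0 (sq_nonneg ‖z‖)]

theorem PsiSetting.integrableOn_j_of_ball_subset {s : Set (Rd d)} (hs : MeasurableSet s) {ρ : ℝ}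
    (hρ : 0 < ρ) (hsρ : ∀ z ∈ s, ρ ≤ ‖z‖) : IntegrableOn (fun z : Rd d => S.j ‖z‖) s := by
  rw [← integrable_indicator_iff hs]
  have := S.integrable_mul_j (F := s.indicator 1) (C := 1) (ρ := ρ)
    ((measurable_one.indicator hs).aestronglyMeasurable) hρ
    (fun z => by by_cases hz : z ∈ s <;> simp [hz])
    (fun z hz => by
      have : z ∉ s := fun h => absurd (hsρ z h) (not_le.2 hz)
      simp [this])
  refine this.congr (ae_of_all _ fun z => ?_)
  by_cases hz : z ∈ s <;> simp [hz]

theorem volume_hyperplane {e : Rd d} (he : ‖e‖ = 1) (c : ℝ) :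
    volume {z : Rd d | ⟪z, e⟫ = c} = 0 := by
  have hsub : volume {z : Rd d | ⟪z, e⟫ = 0} = 0 := by
    have h := Measure.addHaar_submodule volume (ℝ ∙ e)ᗮ (fun h => by
      have he' : e ∈ (ℝ ∙ e)ᗮ := h ▸ Submodule.mem_top
      have := (Submodule.mem_orthogonal_singleton_iff_inner_left).1 he'
      rw [real_inner_self_eq_norm_sq, he] at this
      norm_num at this)
    convert h using 2
    ext z
    simp only [mem_ofPred_eq, SetLike.mem_coe]
    exact (Submodule.mem_orthogonal_singleton_iff_inner_left).symm
  have := measure_preimage_add_right (volume : Measure (Rd d)) (-(c • e)) {z : Rd d | ⟪z, e⟫ = 0}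
  rw [hsub] at this
  rw [← this]
  congr 1
  ext z
  simp [inner_add_left, inner_neg_left, inner_smul_left, he, add_neg_eq_zero]

theorem PsiSetting.setLIntegral_halfSpace {e : Rd d} (he : ‖e‖ = 1) :
    ∫⁻ z in {z : Rd d | ⟪z, e⟫ < 0}, S.lj ‖z‖ = ∞ := by
  have hmeas : Measurable fun z : Rd d => ⟪z, e⟫ := by fun_prop
  have hneg : ∫⁻ z in {z : Rd d | 0 < ⟪z, e⟫}, S.lj ‖z‖ =
      ∫⁻ z in {z : Rd d | ⟪z, e⟫ < 0}, S.lj ‖z‖ := by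
    have := (Measure.measurePreserving_neg (volume : Measure (Rd d))).setLIntegral_comp_preimage
      (s := {z : Rd d | ⟪z, e⟫ < 0}) (hmeas measurableSet_Iio)
      (S.measurable_lj.comp measurable_norm)
    simpa using this
  by_contra h
  have huniv : (Set.univ : Set (Rd d)) ⊆
      ({z | 0 < ⟪z, e⟫} ∪ {z | ⟪z, e⟫ < 0}) ∪ {z | ⟪z, e⟫ = 0} := by
    intro z _
    rcases lt_trichotomy ⟪z, e⟫ 0 with h | h | h
    · exact Or.inl (Or.inr h)
    · exact Or.inr h
    · exact Or.inl (Or.inl h)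
  have h1 := (lintegral_mono_set (μ := volume) (f := fun z : Rd d => S.lj ‖z‖) huniv).trans
    ((lintegral_union_le _ _ _).trans (add_le_add (lintegral_union_le _ _ _) le_rfl))
  rw [setLIntegral_univ, S.lintegral_lj, setLIntegral_measure_zero _ _ (volume_hyperplane he 0), add_zero, hneg,
    top_le_iff, ENNReal.add_eq_top, or_self] at h1
  exact h h1

/-- The mass that the kernel puts on half-spaces approaching the origin is unbounded. -/
theorem PsiSetting.exists_lt_setIntegral_halfSpace (hd : 0 < d) {e : Rd d} (he : ‖e‖ = 1) (L : ℝ) :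
    ∃ δ > 0, ∀ h, 0 < h → h ≤ δ → L < ∫ z in {z : Rd d | ⟪z, e⟫ < -h}, S.j ‖z‖ := by
  have hmeas : Measurable fun z : Rd d => ⟪z, e⟫ := by fun_prop
  have hnorm : ∀ h : ℝ, ∀ z ∈ {z : Rd d | ⟪z, e⟫ < -h}, h ≤ ‖z‖ := by
    intro h z hz
    have h1 := abs_real_inner_le_norm z e
    rw [he, mul_one] at h1
    have : ⟪z, e⟫ < -h := hz
    linarith [neg_abs_le ⟪z, e⟫]
  have hms : ∀ h : ℝ, MeasurableSet {z : Rd d | ⟪z, e⟫ < -h} := fun h => hmeas measurableSet_Iio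
  have hU : (⋃ n : ℕ, {z : Rd d | ⟪z, e⟫ < -(1 / ((n : ℝ) + 1))}) = {z : Rd d | ⟪z, e⟫ < 0} := by
    ext z
    simp only [mem_iUnion, mem_ofPred_eq]
    constructor
    · rintro ⟨n, hn⟩
      have : 0 < 1 / ((n : ℝ) + 1) := by positivity
      linarith
    · intro hz
      obtain ⟨n, hn⟩ := exists_nat_one_div_lt (neg_pos.2 hz)
      exact ⟨n, by linarith⟩
  have hmono : Monotone fun n : ℕ => {z : Rd d | ⟪z, e⟫ < -(1 / ((n : ℝ) + 1))} := by
    intro m n hmn z hz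
    have hz : ⟪z, e⟫ < -(1 / ((m : ℝ) + 1)) := hz
    have : 1 / ((n : ℝ) + 1) ≤ 1 / ((m : ℝ) + 1) := by gcongr
    exact (by linarith : ⟪z, e⟫ < -(1 / ((n : ℝ) + 1)))
  have hsup := setLIntegral_iUnion_of_directed (μ := volume) (fun z : Rd d => S.lj ‖z‖)
    hmono.directed_le
  rw [hU, S.setLIntegral_halfSpace he] at hsup
  obtain ⟨n, hn⟩ := lt_iSup_iff.1 (hsup ▸ (ENNReal.ofReal_lt_top : ENNReal.ofReal L < ∞))
  refine ⟨1 / ((n : ℝ) + 1), by positivity, fun h h0 hh => ?_⟩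
  have hmono' : {z : Rd d | ⟪z, e⟫ < -(1 / ((n : ℝ) + 1))} ⊆ {z : Rd d | ⟪z, e⟫ < -h} := by
    intro z hz
    have hz : ⟪z, e⟫ < -(1 / ((n : ℝ) + 1)) := hz
    exact (by linarith : ⟪z, e⟫ < -h)
  have hI := S.integrableOn_j_of_ball_subset (hms h) h0 (hnorm h)
  have heq : ENNReal.ofReal (∫ z in {z : Rd d | ⟪z, e⟫ < -h}, S.j ‖z‖) =
      ∫⁻ z in {z : Rd d | ⟪z, e⟫ < -h}, S.lj ‖z‖ := by
    rw [ofReal_integral_eq_lintegral_ofReal hI (ae_of_all _ fun z => S.j_nonneg _)]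
    exact setLIntegral_congr_fun (hms h) fun z hz =>
      S.ofReal_j hd (h0.trans_le (hnorm h z hz))
  have hlt : ENNReal.ofReal L < ENNReal.ofReal (∫ z in {z : Rd d | ⟪z, e⟫ < -h}, S.j ‖z‖) :=
    heq ▸ hn.trans_le (lintegral_mono_set hmono')
  by_contra hcon
  exact hlt.not_ge (ENNReal.ofReal_le_ofReal (not_lt.1 hcon))

end Kernel

section Viscosity

variable {d : ℕ} (S : PsiSetting d)

theorem integral_indicator_mul {α : Type*} [MeasurableSpace α] {μ : Measure α} {s : Set α}
    (hs : MeasurableSet s) (f g : α → ℝ) :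
    ∫ z, s.indicator f z * g z ∂μ = ∫ z in s, f z * g z ∂μ := by
  rw [← integral_indicator hs]
  refine integral_congr_ae (ae_of_all _ fun z => ?_)
  by_cases hz : z ∈ s <;> simp [hz]

theorem PsiSetting.integral_symm_inner {A : Set (Rd d)} (hA : ∀ z, -z ∈ A ↔ z ∈ A) (p : Rd d) :
    ∫ z, A.indicator (fun z => ⟪p, z⟫) z * S.j ‖z‖ = 0 := by
  set F : Rd d → ℝ := fun z => A.indicator (fun z => ⟪p, z⟫) z * S.j ‖z‖
  have hodd : ∀ z, F (-z) = -F z := by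
    intro z
    by_cases hz : z ∈ A
    · simp [F, hz, (hA z).2 hz]
    · have hz' : -z ∉ A := fun h => hz ((hA z).1 h)
      simp [F, hz, hz']
  have h := integral_neg_eq_self F volume
  simp only [hodd, integral_neg] at h
  linarith

theorem PsiSetting.integrable_annulus_inner {A : Set (Rd d)} (hA : MeasurableSet A) {s r : ℝ}
    (hs : 0 < s) (hsr : ∀ z ∈ A, s ≤ ‖z‖ ∧ ‖z‖ ≤ r) (p : Rd d) :
    Integrable fun z => A.indicator (fun z => ⟪p, z⟫) z * S.j ‖z‖ := by
  refine S.integrable_mul_j (C := ‖p‖ * |r|) (ρ := s) ?_ hs (fun z => ?_) (fun z hz => ?_)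
  · exact ((by fun_prop : Measurable fun z : Rd d => ⟪p, z⟫).indicator hA).aestronglyMeasurable
  · by_cases hz : z ∈ A
    · rw [indicator_of_mem hz]
      refine (abs_real_inner_le_norm _ _).trans ?_
      have := (hsr z hz).2.trans (le_abs_self r)
      gcongr
    · rw [indicator_of_notMem hz, abs_zero]
      positivity
  · have : z ∉ A := fun h => absurd (hsr z h).1 (not_le.2 hz)
    rw [indicator_of_notMem this, abs_zero]
    positivity

theorem PsiSetting.integrable_ball_sq (s a : ℝ) :
    Integrable fun z : Rd d => (ball 0 s).indicator (fun z => a * ‖z‖ ^ 2) z * S.j ‖z‖ := by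
  refine S.integrable_mul_j (C := |a| * (1 + s ^ 2)) (ρ := 1) ?_ one_pos (fun z => ?_)
    (fun z hz => ?_)
  · exact ((by fun_prop : Measurable fun z : Rd d => a * ‖z‖ ^ 2).indicator
      measurableSet_ball).aestronglyMeasurable
  · by_cases hz : z ∈ ball (0 : Rd d) s
    · rw [indicator_of_mem hz, abs_mul, abs_of_nonneg (sq_nonneg ‖z‖)]
      have hz' : ‖z‖ < s := by simpa using hz
      have : ‖z‖ ^ 2 ≤ s ^ 2 := by gcongr
      gcongr
      linarith
    · rw [indicator_of_notMem hz, abs_zero]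
      positivity
  · by_cases hz : z ∈ ball (0 : Rd d) s
    · rw [indicator_of_mem hz, abs_mul, abs_of_nonneg (sq_nonneg ‖z‖)]
      gcongr
      nlinarith [abs_nonneg a, sq_nonneg s]
    · rw [indicator_of_notMem hz, abs_zero]
      positivity

theorem PsiSetting.integrable_compl_ball {F : Rd d → ℝ} (hF : Measurable F) {C : ℝ}
    (hC : ∀ z, |F z| ≤ C) {s : ℝ} (hs : 0 < s) :
    Integrable fun z : Rd d => (ball 0 s)ᶜ.indicator F z * S.j ‖z‖ := by
  have hC0 : 0 ≤ C := (abs_nonneg _).trans (hC 0)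
  refine S.integrable_mul_j (C := C) (ρ := s) ?_ hs (fun z => ?_) (fun z hz => ?_)
  · exact (hF.indicator measurableSet_ball.compl).aestronglyMeasurable
  · by_cases hz : z ∈ (ball (0 : Rd d) s)ᶜ
    · rw [indicator_of_mem hz]; exact hC z
    · rw [indicator_of_notMem hz, abs_zero]; exact hC0
  · have : z ∉ (ball (0 : Rd d) s)ᶜ := by simpa using hz
    rw [indicator_of_notMem this, abs_zero]
    positivity

/-- The supersolution inequality at `x` with right-hand side `γ`, tested with paraboloids that
touch `v` from below on a ball and with `v` itself outside this ball. -/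
def PsiSetting.ParabolicSuper (v : Rd d → ℝ) (γ : ℝ) (x : Rd d) : Prop :=
  ∀ (p : Rd d) (a s : ℝ), 0 < s → s ≤ 1 →
    (∀ z, ‖z‖ < s → v x + ⟪p, z⟫ - a * ‖z‖ ^ 2 ≤ v (x + z)) →
    γ ≤ a * (∫ z in ball (0 : Rd d) s, ‖z‖ ^ 2 * S.j ‖z‖) +
      ∫ z in (ball (0 : Rd d) s)ᶜ, (v x - v (x + z)) * S.j ‖z‖

/-- A continuous cutoff, equal to `1` for `‖z‖ ≤ s / 2` and to `0` for `s ≤ ‖z‖`. -/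
def cutoff (s : ℝ) (z : Rd d) : ℝ := max 0 (min 1 (2 - 2 * ‖z‖ / s))

theorem continuous_cutoff (s : ℝ) : Continuous (cutoff s : Rd d → ℝ) := by
  unfold cutoff
  fun_prop

theorem cutoff_mem (s : ℝ) (z : Rd d) : 0 ≤ cutoff s z ∧ cutoff s z ≤ 1 :=
  ⟨le_max_left _ _, max_le zero_le_one (min_le_left _ _)⟩

theorem cutoff_eq_one {s : ℝ} (hs : 0 < s) {z : Rd d} (hz : ‖z‖ ≤ s / 2) : cutoff s z = 1 := by
  have : 2 * ‖z‖ / s ≤ 1 := by rw [div_le_one hs]; linarith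
  rw [cutoff, min_eq_left (by linarith), max_eq_right zero_le_one]

theorem cutoff_eq_zero {s : ℝ} (hs : 0 < s) {z : Rd d} (hz : s ≤ ‖z‖) : cutoff s z = 0 := by
  have : 2 ≤ 2 * ‖z‖ / s := by rw [le_div_iff₀ hs]; linarith
  rw [cutoff, max_eq_left ((min_le_right _ _).trans (by linarith))]

/-- The paraboloid of slope `p` and opening `-a` at `x` glued to `v` away from `x`, and lowered
by `κ` away from `x`. -/
def gluedParaboloid (v : Rd d → ℝ) (x p : Rd d) (a κ s : ℝ) (y : Rd d) : ℝ :=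
  v y - cutoff s (y - x) * (v y - (v x + ⟪p, y - x⟫ - a * ‖y - x‖ ^ 2)) -
    κ * min 1 (‖y - x‖ ^ 2)

section Glued

variable {v : Rd d → ℝ} {x p : Rd d} {a κ s : ℝ}

theorem gluedParaboloid_eq_near (hs : 0 < s) (hs1 : s ≤ 1) {y : Rd d} (hy : ‖y - x‖ ≤ s / 2) :
    gluedParaboloid v x p a κ s y = v x + ⟪p, y - x⟫ - (a + κ) * ‖y - x‖ ^ 2 := by
  have : ‖y - x‖ ^ 2 ≤ 1 := by
    have := norm_nonneg (y - x)
    nlinarith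
  rw [gluedParaboloid, cutoff_eq_one hs hy, min_eq_right this]
  ring

theorem gluedParaboloid_eq_far (hs : 0 < s) {y : Rd d} (hy : s ≤ ‖y - x‖) :
    gluedParaboloid v x p a κ s y = v y - κ * min 1 (‖y - x‖ ^ 2) := by
  rw [gluedParaboloid, cutoff_eq_zero hs hy]
  ring

theorem gluedParaboloid_self (hs : 0 < s) (hs1 : s ≤ 1) :
    gluedParaboloid v x p a κ s x = v x := by
  rw [gluedParaboloid_eq_near hs hs1 (by simp; positivity)]
  simp

theorem continuous_gluedParaboloid (hv : Continuous v) :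
    Continuous (gluedParaboloid v x p a κ s) := by
  have := (continuous_cutoff (d := d) s).comp (continuous_id.sub (continuous_const (y := x)))
  unfold gluedParaboloid
  simp only [Function.comp_def] at this
  fun_prop

theorem le_gluedParaboloid
    (hP : ∀ z, ‖z‖ < s → v x + ⟪p, z⟫ - a * ‖z‖ ^ 2 ≤ v (x + z)) {z : Rd d} (hz : ‖z‖ < s) :
    v x + ⟪p, z⟫ - a * ‖z‖ ^ 2 - κ * min 1 (‖z‖ ^ 2) ≤ gluedParaboloid v x p a κ s (x + z) := by
  have h := cutoff_mem s z
  rw [gluedParaboloid, add_sub_cancel_left]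
  nlinarith [mul_nonneg (sub_nonneg.2 h.2) (sub_nonneg.2 (hP z hz))]

theorem gluedParaboloid_lt (hs : 0 < s) (hκ : 0 < κ)
    (hP : ∀ z, ‖z‖ < s → v x + ⟪p, z⟫ - a * ‖z‖ ^ 2 ≤ v (x + z)) {y : Rd d} (hy : y ≠ x) :
    gluedParaboloid v x p a κ s y < v y := by
  have h0 : 0 < ‖y - x‖ := norm_pos_iff.2 (sub_ne_zero.2 hy)
  have h1 : 0 < κ * min 1 (‖y - x‖ ^ 2) := by positivity
  rcases lt_or_ge ‖y - x‖ s with h | h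
  · have h2 := hP _ h
    rw [add_sub_cancel] at h2
    have h3 := mul_nonneg (cutoff_mem s (y - x)).1 (sub_nonneg.2 h2)
    rw [gluedParaboloid]
    linarith
  · rw [gluedParaboloid_eq_far hs h]
    linarith

theorem abs_gluedParaboloid_le {M : ℝ} (hM : ∀ y, |v y| ≤ M) (hs : 0 < s) (hκ : 0 < κ)
    (y : Rd d) :
    |gluedParaboloid v x p a κ s y| ≤ M + (2 * M + ‖p‖ * s + |a| * s ^ 2) + κ := by
  have hM0 : 0 ≤ M := (abs_nonneg _).trans (hM x)
  have h1 : |κ * min 1 (‖y - x‖ ^ 2)| ≤ κ := by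
    have h2 : 0 ≤ min 1 (‖y - x‖ ^ 2) := by positivity
    rw [abs_of_nonneg (by positivity)]
    exact mul_le_of_le_one_right hκ.le (min_le_left _ _)
  have h2 : |cutoff s (y - x) * (v y - (v x + ⟪p, y - x⟫ - a * ‖y - x‖ ^ 2))| ≤
      2 * M + ‖p‖ * s + |a| * s ^ 2 := by
    rcases lt_or_ge ‖y - x‖ s with h | h
    · have hc := cutoff_mem s (y - x)
      rw [abs_mul, abs_of_nonneg hc.1]
      refine (mul_le_of_le_one_left (abs_nonneg _) hc.2).trans ?_
      have h3 : |⟪p, y - x⟫| ≤ ‖p‖ * s := (abs_real_inner_le_norm _ _).trans (by gcongr)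
      have h4 : |a * ‖y - x‖ ^ 2| ≤ |a| * s ^ 2 := by
        rw [abs_mul, abs_of_nonneg (sq_nonneg ‖y - x‖)]
        gcongr
      rw [abs_le] at *
      have h5 := abs_le.1 (hM x)
      have h6 := abs_le.1 (hM y)
      constructor <;> linarith
    · rw [cutoff_eq_zero hs h, zero_mul, abs_zero]
      positivity
  rw [gluedParaboloid]
  refine (abs_sub _ _).trans (add_le_add ((abs_sub _ _).trans (add_le_add (hM y) h2)) h1)

theorem eventually_near (hs : 0 < s) : ∀ᶠ y in 𝓝 x, ‖y - x‖ ≤ s / 2 := by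
  filter_upwards [ball_mem_nhds x (half_pos hs)] with y hy
  rw [mem_ball, dist_eq_norm] at hy
  exact hy.le

theorem testAt_gluedParaboloid (hv : Continuous v) {M : ℝ} (hM : ∀ y, |v y| ≤ M)
    (hs : 0 < s) (hs1 : s ≤ 1) (hκ : 0 < κ) :
    TestAt x (gluedParaboloid v x p a κ s) := by
  refine ⟨⟨_, abs_gluedParaboloid_le hM hs hκ⟩, continuous_gluedParaboloid hv,
    {y | ‖y - x‖ ≤ s / 2}, eventually_near hs, ?_⟩
  refine ContDiffOn.congr (f := fun y => v x + ⟪p, y - x⟫ - (a + κ) * ‖y - x‖ ^ 2) ?_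
    fun y hy => gluedParaboloid_eq_near hs hs1 hy
  have h1 : ContDiff ℝ 2 fun y : Rd d => y - x := contDiff_id.sub contDiff_const
  have h2 : ContDiff ℝ 2 fun y : Rd d => ⟪p, y - x⟫ := contDiff_const.inner ℝ h1
  have h3 : ContDiff ℝ 2 fun y : Rd d => ‖y - x‖ ^ 2 := h1.norm_sq ℝ
  exact ((contDiff_const.add h2).sub (contDiff_const.mul h3)).contDiffOn

theorem gradient_gluedParaboloid (hs : 0 < s) (hs1 : s ≤ 1) :
    gradient (gluedParaboloid v x p a κ s) x = p := by
  have hg : HasGradientAt (fun y => v x + ⟪p, y - x⟫ - (a + κ) * ‖y - x‖ ^ 2) p x := by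
    rw [hasGradientAt_iff_isLittleO]
    have h0 : (fun y : Rd d => -(a + κ) * ‖y - x‖ ^ 2) =o[𝓝 x] fun y => y - x := by
      refine IsLittleO.const_mul_left ?_ _
      have h1 : Tendsto (fun y : Rd d => y - x) (𝓝 x) (𝓝 0) :=
        (continuous_id.sub continuous_const).tendsto' _ _ (by simp)
      exact (isLittleO_norm_pow_id one_lt_two).comp_tendsto h1
    refine h0.congr_left fun y => ?_
    simp only [sub_self, inner_zero_right, norm_zero]
    ring
  refine HasGradientAt.gradient (hg.congr_of_eventuallyEq ?_)
  filter_upwards [eventually_near hs] with y hy using gluedParaboloid_eq_near hs hs1 hy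

end Glued

/-- The viscosity inequality for test functions implies the one for paraboloids. -/
theorem PsiSetting.parabolicSuper_of_test {v : Rd d → ℝ} (hv : Continuous v) {M : ℝ}
    (hM : ∀ y, |v y| ≤ M) {γ : ℝ} {x : Rd d}
    (h : ∀ φ : Rd d → ℝ, TestAt x φ → φ x = v x → (∀ y, y ≠ x → φ y < v y) →
      γ ≤ psiOp S φ x) : S.ParabolicSuper v γ x := by
  intro p a s hs hs1 hP
  have hM0 : 0 ≤ M := (abs_nonneg _).trans (hM x)
  set Y : ℝ := ∫ z : Rd d, min 1 (‖z‖ ^ 2) * S.j ‖z‖ with hY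
  have hY0 : 0 ≤ Y := integral_nonneg fun z => mul_nonneg (by positivity) (S.j_nonneg _)
  suffices hκ : ∀ κ > 0, γ ≤ a * (∫ z in ball (0 : Rd d) s, ‖z‖ ^ 2 * S.j ‖z‖) +
      (∫ z in (ball (0 : Rd d) s)ᶜ, (v x - v (x + z)) * S.j ‖z‖) + κ * Y by
    refine le_of_forall_pos_le_add fun ε hε => (hκ (ε / (Y + 1)) (by positivity)).trans ?_
    have : ε / (Y + 1) * Y ≤ ε := by
      rw [div_mul_eq_mul_div, div_le_iff₀ (by positivity)]
      nlinarith
    linarith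
  intro κ hκ
  set φ := gluedParaboloid v x p a κ s with hφ
  have hφx : φ x = v x := gluedParaboloid_self hs hs1
  refine (h φ (testAt_gluedParaboloid hv hM hs hs1 hκ) hφx
    fun y hy => gluedParaboloid_lt hs hκ hP hy).trans ?_
  have hF : Measurable fun z => v x - v (x + z) := by fun_prop
  have hFb : ∀ z, |v x - v (x + z)| ≤ 2 * M := fun z => by
    have h1 := abs_le.1 (hM x)
    have h2 := abs_le.1 (hM (x + z))
    rw [abs_le]
    constructor <;> linarith
  have i1 := S.integrable_ball_sq s a
  have i2 := S.integrable_compl_ball hF hFb hs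
  have i3 := (S.integrable_min_mul_j).const_mul κ
  have i4 := S.integrable_annulus_inner (A := (ball 0 s)ᶜ ∩ closedBall 0 1)
    (measurableSet_ball.compl.inter measurableSet_closedBall) (r := 1) hs (by simp) p
  have hbound : ∫ z : Rd d, ((ball 0 s).indicator (fun z => a * ‖z‖ ^ 2) z * S.j ‖z‖ +
      (ball 0 s)ᶜ.indicator (fun z => v x - v (x + z)) z * S.j ‖z‖ +
      κ * (min 1 (‖z‖ ^ 2) * S.j ‖z‖) +
      ((ball 0 s)ᶜ ∩ closedBall 0 1).indicator (fun z => ⟪p, z⟫) z * S.j ‖z‖) =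
      a * (∫ z in ball (0 : Rd d) s, ‖z‖ ^ 2 * S.j ‖z‖) +
      (∫ z in (ball (0 : Rd d) s)ᶜ, (v x - v (x + z)) * S.j ‖z‖) + κ * Y := by
    rw [integral_add ((i1.fun_add i2).fun_add i3) i4, integral_add (i1.fun_add i2) i3,
      integral_add i1 i2,
      S.integral_symm_inner (by simp), integral_indicator_mul measurableSet_ball,
      integral_indicator_mul measurableSet_ball.compl, integral_const_mul, add_zero]
    simp only [mul_assoc, integral_const_mul, hY]
  rw [← hbound, psiOp, hφ, gradient_gluedParaboloid hs hs1, ← hφ, hφx]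
  obtain ⟨K, hK⟩ : ∃ K, ∀ y, |φ y| ≤ K := ⟨_, abs_gluedParaboloid_le hM hs hκ⟩
  have hK0 : 0 ≤ K := (abs_nonneg _).trans (hK x)
  refine integral_mono ?_ (((i1.add i2).add i3).add i4) fun z => ?_
  · refine S.integrable_mul_j (C := M + K + ‖p‖ + |a + κ|) (ρ := s / 2) ?_ (half_pos hs)
      (fun z => ?_) (fun z hz => ?_)
    · have hφm : Measurable φ := (continuous_gluedParaboloid hv).measurable
      exact (((measurable_const.sub (hφm.comp (measurable_const.add measurable_id)))).add
        (Measurable.ite (measurableSet_le measurable_norm measurable_const)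
          (by fun_prop) measurable_const)).aestronglyMeasurable
    · have h1 := abs_le.1 (hM x)
      have h2 := abs_le.1 (hK (x + z))
      have h3 : |if ‖z‖ ≤ 1 then ⟪z, p⟫ else 0| ≤ ‖p‖ := by
        split_ifs with hz
        · refine (abs_real_inner_le_norm _ _).trans (mul_le_of_le_one_left (norm_nonneg _) hz)
        · simp
      have h4 := abs_le.1 h3
      have h5 := abs_nonneg (a + κ)
      rw [abs_le]
      constructor <;> linarith
    · have h1 : φ (x + z) = v x + ⟪p, z⟫ - (a + κ) * ‖z‖ ^ 2 := by
        rw [hφ, gluedParaboloid_eq_near hs hs1 (by simpa using hz.le), add_sub_cancel_left]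
      rw [h1, if_pos (by linarith), real_inner_comm p z]
      have : v x - (v x + ⟪p, z⟫ - (a + κ) * ‖z‖ ^ 2) + ⟪p, z⟫ = (a + κ) * ‖z‖ ^ 2 := by ring
      rw [this, abs_mul, abs_of_nonneg (sq_nonneg ‖z‖)]
      gcongr
      have := norm_nonneg p
      linarith
  · simp only
    rw [← mul_assoc κ, ← add_mul, ← add_mul, ← add_mul]
    refine mul_le_mul_of_nonneg_right ?_ (S.j_nonneg _)
    rcases lt_or_ge ‖z‖ s with hz | hz
    · have m1 : z ∈ ball (0 : Rd d) s := by simpa using hz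
      have m2 : z ∉ (ball (0 : Rd d) s)ᶜ := fun h => h m1
      have m3 : z ∉ (ball (0 : Rd d) s)ᶜ ∩ closedBall 0 1 := fun h => m2 h.1
      rw [indicator_of_mem m1, indicator_of_notMem m2, indicator_of_notMem m3,
        if_pos (by linarith), real_inner_comm]
      have := le_gluedParaboloid (κ := κ) hP hz
      linarith
    · have m1 : z ∉ ball (0 : Rd d) s := by simpa using hz
      have m2 : z ∈ (ball (0 : Rd d) s)ᶜ := m1
      have e : φ (x + z) = v (x + z) - κ * min 1 (‖z‖ ^ 2) := by
        rw [hφ, gluedParaboloid_eq_far hs (by simpa using hz), add_sub_cancel_left]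
      rw [indicator_of_notMem m1, indicator_of_mem m2, e]
      by_cases hz1 : ‖z‖ ≤ 1
      · have m3 : z ∈ (ball (0 : Rd d) s)ᶜ ∩ closedBall 0 1 := ⟨m2, by simpa using hz1⟩
        rw [if_pos hz1, indicator_of_mem m3, real_inner_comm]
        linarith
      · rw [if_neg hz1, indicator_of_notMem (fun h => hz1 (by simpa using h.2))]
        linarith

theorem psiOp_neg (φ : Rd d → ℝ) (x : Rd d) : psiOp S (fun y => -φ y) x = -psiOp S φ x := by
  have hg : gradient (fun y => -φ y) x = -gradient φ x := by
    simp [gradient, fderiv_fun_neg]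
  rw [psiOp, psiOp, ← integral_neg]
  refine integral_congr_ae (ae_of_all _ fun z => ?_)
  simp only [hg, inner_neg_right]
  split_ifs <;> ring

theorem TestAt.neg {x : Rd d} {φ : Rd d → ℝ} (h : TestAt x φ) : TestAt x fun y => -φ y := by
  obtain ⟨⟨M, hM⟩, hc, U, hU, hd⟩ := h
  exact ⟨⟨M, fun y => by rw [abs_neg]; exact hM y⟩, hc.neg, U, hU, hd.neg⟩

end Viscosity

section Comparison

variable {d : ℕ} (S : PsiSetting d)

theorem tendsto_volume_ball_nhdsGT_zero (hd : 0 < d) :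
    Tendsto (fun s : ℝ => volume (ball (0 : Rd d) s)) (𝓝[>] 0) (𝓝 0) := by
  have : Nonempty (Fin d) := ⟨⟨0, hd⟩⟩
  have h := tendsto_measure_biInter_gt (μ := (volume : Measure (Rd d))) (a := (0 : ℝ))
    (s := fun s => ball (0 : Rd d) s) (fun _ _ => measurableSet_ball.nullMeasurableSet)
    (fun _ _ _ hij => ball_subset_ball hij) ⟨1, one_pos, measure_ball_lt_top.ne⟩
  have h0 : (⋂ r : ℝ, ⋂ (_ : r > 0), ball (0 : Rd d) r) = {0} := by
    ext z
    simp only [mem_iInter, mem_ball_zero_iff, mem_singleton_iff, gt_iff_lt]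
    refine ⟨fun hz => ?_, fun hz => by simp [hz]⟩
    by_contra hne
    exact lt_irrefl _ (hz _ (norm_pos_iff.2 hne))
  rwa [h0, measure_singleton] at h

/-- The inequalities of two supersolutions at points where their sum is almost minimal along the
diagonal can be added up. -/
theorem PsiSetting.ParabolicSuper.add_le {S : PsiSetting d} (hd : 0 < d) {v w : Rd d → ℝ} (hv : Continuous v)
    (hw : Continuous w) {M : ℝ} (hMv : ∀ y, |v y| ≤ M) (hMw : ∀ y, |w y| ≤ M) {γ₁ γ₂ : ℝ}
    {x y : Rd d} (h₁ : S.ParabolicSuper v γ₁ x) (h₂ : S.ParabolicSuper w γ₂ y) {p q b : Rd d}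
    {a₁ a₂ η ρ : ℝ} (hη : 0 ≤ η) (hρ : 0 < ρ)
    (hp : ∀ z, ‖z‖ < ρ → v x + ⟪p, z⟫ - a₁ * ‖z‖ ^ 2 ≤ v (x + z))
    (hq : ∀ z, ‖z‖ < ρ → w y + ⟪q, z⟫ - a₂ * ‖z‖ ^ 2 ≤ w (y + z))
    (hb : ∀ z, ‖z‖ < ρ →
      (v x - v (x + z)) + (w y - w (y + z)) ≤ η * ‖z‖ ^ 2 + ⟪b, z⟫) :
    γ₁ + γ₂ ≤ η * (∫ z in ball (0 : Rd d) ρ, ‖z‖ ^ 2 * S.j ‖z‖) +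
      ∫ z in (ball (0 : Rd d) ρ)ᶜ, ((v x - v (x + z)) + (w y - w (y + z))) * S.j ‖z‖ := by
  set G : Rd d → ℝ := fun z => (v x - v (x + z)) + (w y - w (y + z)) with hG
  have hGm : Measurable G := by fun_prop
  have hF₁ : Measurable fun z => v x - v (x + z) := by fun_prop
  have hF₂ : Measurable fun z => w y - w (y + z) := by fun_prop
  have hb₁ : ∀ z, |v x - v (x + z)| ≤ 2 * M := fun z => by
    have h1 := abs_le.1 (hMv x)
    have h2 := abs_le.1 (hMv (x + z))
    rw [abs_le]
    constructor <;> linarith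
  have hb₂ : ∀ z, |w y - w (y + z)| ≤ 2 * M := fun z => by
    have h1 := abs_le.1 (hMw y)
    have h2 := abs_le.1 (hMw (y + z))
    rw [abs_le]
    constructor <;> linarith
  have hGb : ∀ z, |G z| ≤ 4 * M := fun z =>
    (abs_add_le _ _).trans (by linarith [hb₁ z, hb₂ z])
  have i1 := S.integrable_ball_sq ρ η
  have i2 := S.integrable_compl_ball hGm hGb hρ
  set R : ℝ := η * (∫ z in ball (0 : Rd d) ρ, ‖z‖ ^ 2 * S.j ‖z‖) +
      ∫ z in (ball (0 : Rd d) ρ)ᶜ, G z * S.j ‖z‖ with hR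
  have key : ∀ s, 0 < s → s < min ρ 1 →
      γ₁ + γ₂ ≤ (a₁ + a₂) * (∫ z in ball (0 : Rd d) s, ‖z‖ ^ 2 * S.j ‖z‖) + R := by
    intro s hs hsr
    have hsρ : s < ρ := hsr.trans_le (min_le_left _ _)
    have hs1 : s ≤ 1 := hsr.le.trans (min_le_right _ _)
    have k1 := h₁ p a₁ s hs hs1 fun z hz => hp z (hz.trans hsρ)
    have k2 := h₂ q a₂ s hs hs1 fun z hz => hq z (hz.trans hsρ)
    have j1 := S.integrable_compl_ball hF₁ hb₁ hs
    have j2 := S.integrable_compl_ball hF₂ hb₂ hs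
    have i3 := S.integrable_annulus_inner (A := (ball 0 s)ᶜ ∩ ball 0 ρ)
      (measurableSet_ball.compl.inter measurableSet_ball) (r := ρ) hs
      (fun z hz => ⟨by simpa using hz.1, by simpa using (mem_ball_zero_iff.1 hz.2).le⟩) b
    have e1 : (∫ z in (ball (0 : Rd d) s)ᶜ, (v x - v (x + z)) * S.j ‖z‖) +
        (∫ z in (ball (0 : Rd d) s)ᶜ, (w y - w (y + z)) * S.j ‖z‖) =
        ∫ z : Rd d, ((ball (0 : Rd d) s)ᶜ.indicator (fun z => v x - v (x + z)) z * S.j ‖z‖ +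
          (ball (0 : Rd d) s)ᶜ.indicator (fun z => w y - w (y + z)) z * S.j ‖z‖) := by
      rw [integral_add j1 j2, integral_indicator_mul measurableSet_ball.compl,
        integral_indicator_mul measurableSet_ball.compl]
    have e2 : ∫ z : Rd d, ((ball 0 ρ).indicator (fun z => η * ‖z‖ ^ 2) z * S.j ‖z‖ +
        (ball 0 ρ)ᶜ.indicator G z * S.j ‖z‖ +
        ((ball 0 s)ᶜ ∩ ball 0 ρ).indicator (fun z => ⟪b, z⟫) z * S.j ‖z‖) = R := by
      rw [integral_add (i1.fun_add i2) i3, integral_add i1 i2, S.integral_symm_inner (by simp),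
        integral_indicator_mul measurableSet_ball, integral_indicator_mul measurableSet_ball.compl,
        add_zero]
      simp only [mul_assoc, integral_const_mul, hR]
    have e3 : (∫ z in (ball (0 : Rd d) s)ᶜ, (v x - v (x + z)) * S.j ‖z‖) +
        (∫ z in (ball (0 : Rd d) s)ᶜ, (w y - w (y + z)) * S.j ‖z‖) ≤ R := by
      rw [e1, ← e2]
      refine integral_mono (j1.fun_add j2) ((i1.fun_add i2).fun_add i3) fun z => ?_
      simp only
      rw [← add_mul, ← add_mul, ← add_mul]
      refine mul_le_mul_of_nonneg_right ?_ (S.j_nonneg _)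
      rcases lt_or_ge ‖z‖ s with hz | hz
      · have m1 : z ∉ (ball (0 : Rd d) s)ᶜ := by simpa using hz
        have m2 : z ∈ ball (0 : Rd d) ρ := by simpa using hz.trans hsρ
        rw [indicator_of_notMem m1, indicator_of_notMem m1, indicator_of_mem m2,
          indicator_of_notMem (not_not_intro m2), indicator_of_notMem (fun h => m1 h.1)]
        have : 0 ≤ η * ‖z‖ ^ 2 := by positivity
        linarith
      · have m1 : z ∈ (ball (0 : Rd d) s)ᶜ := by simpa using hz
        rw [indicator_of_mem m1, indicator_of_mem m1]
        by_cases hzρ : z ∈ ball (0 : Rd d) ρ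
        · rw [indicator_of_mem hzρ, indicator_of_notMem (not_not_intro hzρ),
            indicator_of_mem (mem_inter m1 hzρ)]
          linarith [hb z (by simpa using hzρ)]
        · rw [indicator_of_notMem hzρ, indicator_of_mem hzρ,
            indicator_of_notMem (fun h => hzρ h.2)]
          simp only [hG]
          linarith
    linarith
  have hint : IntegrableOn (fun z : Rd d => ‖z‖ ^ 2 * S.j ‖z‖) (ball 0 1) := by
    have := S.integrable_ball_sq 1 1
    rw [← integrable_indicator_iff measurableSet_ball]
    refine this.congr (ae_of_all _ fun z => ?_)
    by_cases hz : z ∈ ball (0 : Rd d) 1 <;> simp [hz]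
  have hvol : Tendsto (fun s : ℝ => volume.restrict (ball (0 : Rd d) 1) (ball (0 : Rd d) s))
      (𝓝[>] 0) (𝓝 0) := by
    refine tendsto_of_tendsto_of_tendsto_of_le_of_le tendsto_const_nhds
      (tendsto_volume_ball_nhdsGT_zero hd) (fun _ => bot_le) fun s => Measure.restrict_apply_le _ _
  have hlim := hint.tendsto_setIntegral_nhds_zero hvol
  have hlim' : Tendsto (fun s : ℝ => (a₁ + a₂) *
      (∫ z in ball (0 : Rd d) s, ‖z‖ ^ 2 * S.j ‖z‖) + R) (𝓝[>] 0) (𝓝 ((a₁ + a₂) * 0 + R)) := by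
    refine ((hlim.const_mul _).add_const R).congr' ?_
    filter_upwards [Ioo_mem_nhdsGT one_pos] with s hs
    rw [Measure.restrict_restrict measurableSet_ball,
      inter_eq_self_of_subset_left (ball_subset_ball hs.2.le)]
  rw [mul_zero, zero_add] at hlim'
  refine ge_of_tendsto hlim' ?_
  filter_upwards [Ioo_mem_nhdsGT (lt_min hρ one_pos)] with s hs using key s hs.1 hs.2

/-- Doubling of variables: penalised minimum points converge to a minimum point of `v - u`. -/
theorem exists_doubling {v u : Rd d → ℝ} (hv : Continuous v) (hu : Continuous u) {M : ℝ}
    (hMv : ∀ y, |v y| ≤ M) (hMu : ∀ y, |u y| ≤ M) {x₀ : Rd d} {δ : ℝ} (hδ : 0 < δ)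
    (hmin : ∀ x ∈ closedBall x₀ δ, v x₀ - u x₀ ≤ v x - u x) {η τ : ℝ} (hη : 0 < η)
    (hτ : 0 < τ) :
    ∃ (N : ℝ) (x y : Rd d), dist x x₀ < τ ∧ dist y x₀ < τ ∧
      ∀ x' ∈ closedBall x₀ δ, ∀ y' ∈ closedBall x₀ δ,
        v x - u y + N * ‖x - y‖ ^ 2 + η * ‖x - x₀‖ ^ 2 ≤
          v x' - u y' + N * ‖x' - y'‖ ^ 2 + η * ‖x' - x₀‖ ^ 2 := by
  have hM0 : 0 ≤ M := (abs_nonneg _).trans (hMv x₀)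
  have hK : IsCompact (closedBall x₀ δ) := isCompact_closedBall x₀ δ
  obtain ⟨σ, hσ, hσu⟩ := Metric.uniformContinuousOn_iff.1
    (hK.uniformContinuousOn_of_continuous hu.continuousOn) (η * (τ / 2) ^ 2) (by positivity)
  set σ' := min σ (τ / 2) with hσ'
  have hσ'0 : 0 < σ' := lt_min hσ (by positivity)
  set N : ℝ := (4 * M + 1) / σ' ^ 2 with hN
  have hN0 : 0 ≤ N := by positivity
  have hx₀ : x₀ ∈ closedBall x₀ δ := mem_closedBall_self hδ.le
  obtain ⟨⟨x, y⟩, ⟨hx, hy⟩, hxy⟩ := (hK.prod hK).exists_isMinOn ⟨(x₀, x₀), hx₀, hx₀⟩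
    (f := fun q : Rd d × Rd d =>
      v q.1 - u q.2 + N * ‖q.1 - q.2‖ ^ 2 + η * ‖q.1 - x₀‖ ^ 2) (by fun_prop)
  simp only at hx hy
  have hmin' : ∀ x' ∈ closedBall x₀ δ, ∀ y' ∈ closedBall x₀ δ,
        v x - u y + N * ‖x - y‖ ^ 2 + η * ‖x - x₀‖ ^ 2 ≤
          v x' - u y' + N * ‖x' - y'‖ ^ 2 + η * ‖x' - x₀‖ ^ 2 :=
    fun x' hx' y' hy' => hxy (show (x', y') ∈ closedBall x₀ δ ×ˢ closedBall x₀ δ from ⟨hx', hy'⟩)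
  have h0 := hmin' x₀ hx₀ x₀ hx₀
  simp only [sub_self, norm_zero, ne_eq, OfNat.ofNat_ne_zero, not_false_eq_true, zero_pow,
    mul_zero, add_zero] at h0
  have b1 := abs_le.1 (hMv x)
  have b2 := abs_le.1 (hMv x₀)
  have b3 := abs_le.1 (hMu y)
  have b4 := abs_le.1 (hMu x₀)
  have hp1 : 0 ≤ N * ‖x - y‖ ^ 2 := by positivity
  have hp2 : 0 ≤ η * ‖x - x₀‖ ^ 2 := by positivity
  have hdxy : ‖x - y‖ < σ' := by
    by_contra! hcon
    have h1 : N * σ' ^ 2 ≤ N * ‖x - y‖ ^ 2 := by gcongr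
    rw [hN, div_mul_cancel₀ _ (by positivity)] at h1
    linarith
  have hdx : ‖x - x₀‖ < τ / 2 := by
    have h1 := hσu x hx y hy (by rw [dist_eq_norm]; exact hdxy.trans_le (min_le_left _ _))
    rw [Real.dist_eq] at h1
    have h2 := (abs_lt.1 h1).1
    have h3 := hmin x hx
    have h4 : η * ‖x - x₀‖ ^ 2 < η * (τ / 2) ^ 2 := by linarith
    exact lt_of_pow_lt_pow_left₀ 2 (by positivity) (lt_of_mul_lt_mul_left h4 hη.le)
  refine ⟨N, x, y, ?_, ?_, hmin'⟩
  · rw [dist_eq_norm]; linarith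
  · have h1 : ‖x - y‖ < τ / 2 := hdxy.trans_le (min_le_right _ _)
    calc dist y x₀ ≤ dist y x + dist x x₀ := dist_triangle _ _ _
      _ = ‖x - y‖ + ‖x - x₀‖ := by rw [dist_comm, dist_eq_norm, dist_eq_norm]
      _ < τ := by linarith

/-- The difference of a supersolution and a subsolution satisfies the expected inequality at a
local minimum point. -/
theorem PsiSetting.sub_le_at_min (hd : 0 < d) {v u : Rd d → ℝ} (hv : Continuous v) (hu : Continuous u) {M : ℝ}
    (hMv : ∀ y, |v y| ≤ M) (hMu : ∀ y, |u y| ≤ M) {γv γu : Rd d → ℝ} {x₀ : Rd d} {δ : ℝ}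
    (hγv : ContinuousAt γv x₀) (hγu : ContinuousAt γu x₀)
    (hsv : ∀ x ∈ closedBall x₀ δ, S.ParabolicSuper v (γv x) x)
    (hsu : ∀ x ∈ closedBall x₀ δ, S.ParabolicSuper (fun y => -u y) (-γu x) x)
    (hmin : ∀ x ∈ closedBall x₀ δ, v x₀ - u x₀ ≤ v x - u x) {ρ : ℝ} (hρ : 0 < ρ) (hρδ : ρ < δ) :
    γv x₀ - γu x₀ ≤ ∫ z in (ball (0 : Rd d) ρ)ᶜ,
      ((v x₀ - v (x₀ + z)) + (u (x₀ + z) - u x₀)) * S.j ‖z‖ := by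
  have hδ : 0 < δ := hρ.trans hρδ
  set C := ∫ z in ball (0 : Rd d) ρ, ‖z‖ ^ 2 * S.j ‖z‖ with hC
  have hC0 : 0 ≤ C := integral_nonneg fun z => mul_nonneg (sq_nonneg _) (S.j_nonneg _)
  set Θ : Rd d × Rd d → ℝ := fun q => ∫ z in (ball (0 : Rd d) ρ)ᶜ,
    ((v q.1 - v (q.1 + z)) + (u (q.2 + z) - u q.2)) * S.j ‖z‖ with hΘ
  have hΘc : Continuous Θ := by
    refine continuous_of_dominated (bound := fun z => 4 * M * S.j ‖z‖) (fun q => ?_) (fun q => ?_)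
      ?_ ?_
    · exact ((by fun_prop : Measurable fun z =>
        (v q.1 - v (q.1 + z)) + (u (q.2 + z) - u q.2)).mul
          S.measurable_j_norm).aestronglyMeasurable
    · refine ae_of_all _ fun z => ?_
      rw [norm_mul, Real.norm_eq_abs, Real.norm_eq_abs, abs_of_nonneg (S.j_nonneg _)]
      refine mul_le_mul_of_nonneg_right ?_ (S.j_nonneg _)
      have h1 := abs_le.1 (hMv q.1)
      have h2 := abs_le.1 (hMv (q.1 + z))
      have h3 := abs_le.1 (hMu q.2)
      have h4 := abs_le.1 (hMu (q.2 + z))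
      rw [abs_le]
      constructor <;> linarith
    · exact (S.integrableOn_j_of_ball_subset measurableSet_ball.compl hρ (by simp)).const_mul _
    · refine ae_of_all _ fun z => ?_
      fun_prop
  suffices hη : ∀ η > 0, γv x₀ - γu x₀ - Θ (x₀, x₀) ≤ η * C by
    have : γv x₀ - γu x₀ - Θ (x₀, x₀) ≤ 0 := by
      refine le_of_forall_pos_le_add fun ε hε => ?_
      refine (hη (ε / (C + 1)) (by positivity)).trans ?_
      rw [zero_add, div_mul_eq_mul_div, div_le_iff₀ (by positivity)]
      nlinarith
    linarith
  intro η hη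
  have hcont : Tendsto (fun q : Rd d × Rd d => γv q.1 - γu q.2 - Θ q) (𝓝 (x₀, x₀))
      (𝓝 (γv x₀ - γu x₀ - Θ (x₀, x₀))) := by
    have h1 : ContinuousAt (fun q : Rd d × Rd d => γv q.1) (x₀, x₀) :=
      ContinuousAt.comp (f := Prod.fst) (g := γv) hγv continuousAt_fst
    have h2 : ContinuousAt (fun q : Rd d × Rd d => γu q.2) (x₀, x₀) :=
      ContinuousAt.comp (f := Prod.snd) (g := γu) hγu continuousAt_snd
    exact (h1.sub h2).sub hΘc.continuousAt
  refine le_of_tendsto_of_frequently hcont ?_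
  rw [Metric.nhds_basis_ball.frequently_iff]
  intro ε hε
  obtain ⟨N, x, y, hx, hy, hxy⟩ := exists_doubling hv hu hMv hMu hδ hmin hη
    (lt_min hε (sub_pos.2 hρδ))
  refine ⟨(x, y), ?_, ?_⟩
  · rw [mem_ball, Prod.dist_eq]
    exact max_lt (hx.trans_le (min_le_left _ _)) (hy.trans_le (min_le_left _ _))
  have hx' : dist x x₀ < δ - ρ := hx.trans_le (min_le_right _ _)
  have hy' : dist y x₀ < δ - ρ := hy.trans_le (min_le_right _ _)
  have hmem : ∀ {x z : Rd d}, dist x x₀ < δ - ρ → ‖z‖ < ρ → x + z ∈ closedBall x₀ δ := by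
    intro x z hx hz
    rw [mem_closedBall]
    calc dist (x + z) x₀ ≤ dist (x + z) x + dist x x₀ := dist_triangle _ _ _
      _ ≤ δ := by rw [dist_self_add_left]; linarith
  have hxm : x ∈ closedBall x₀ δ := by simpa using hmem (z := 0) hx' (by simpa using hρ)
  have hym : y ∈ closedBall x₀ δ := by simpa using hmem (z := 0) hy' (by simpa using hρ)
  have hadd := (hsv x hxm).add_le hd (b := (2 * η) • (x - x₀))
    (p := -((2 * N) • (x - y) + (2 * η) • (x - x₀)))
    (q := (2 * N) • (x - y)) (a₁ := N + η) (a₂ := N) hv hu.fun_neg hMv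
    (fun y => by simpa using hMu y) (hsu y hym) hη.le hρ ?_ ?_ ?_
  · simp only [neg_sub_neg] at hadd
    simp only [hΘ]
    linarith
  · intro z hz
    have h := hxy (x + z) (hmem hx' hz) y hym
    rw [show x + z - y = (x - y) + z by abel, show x + z - x₀ = (x - x₀) + z by abel,
      norm_add_sq_real, norm_add_sq_real] at h
    simp only [inner_neg_left, inner_add_left, real_inner_smul_left] at h ⊢
    linarith
  · intro z hz
    have h := hxy x hxm (y + z) (hmem hy' hz)
    rw [show x - (y + z) = (x - y) - z by abel, norm_sub_sq_real (x - y)] at h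
    simp only [real_inner_smul_left] at h ⊢
    linarith
  · intro z hz
    have h := hxy (x + z) (hmem hx' hz) (y + z) (hmem hy' hz)
    rw [show x + z - (y + z) = x - y by abel, show x + z - x₀ = (x - x₀) + z by abel,
      norm_add_sq_real] at h
    simp only [real_inner_smul_left] at h ⊢
    linarith

end Comparison

section Reflection

variable {d : ℕ} {e : Rd d}

theorem reflAt_eq (he : ‖e‖ = 1) (lam : ℝ) (x : Rd d) :
    reflAt e lam x = (ℝ ∙ e)ᗮ.reflection x + (2 * lam) • e := by
  rw [Submodule.reflection_orthogonal_apply, Submodule.reflection_singleton_apply, he,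
    real_inner_comm, reflAt]
  simp only [RCLike.ofReal_real_eq_id, id_eq, one_pow, div_one]
  module

theorem inner_reflAt (he : ‖e‖ = 1) (lam : ℝ) (x : Rd d) :
    ⟪reflAt e lam x, e⟫ = 2 * lam - ⟪x, e⟫ := by
  rw [reflAt, inner_sub_left, real_inner_smul_left, real_inner_self_eq_norm_sq, he]
  ring

theorem reflAt_reflAt (he : ‖e‖ = 1) (lam : ℝ) (x : Rd d) :
    reflAt e lam (reflAt e lam x) = x := by
  rw [reflAt, inner_reflAt he, reflAt]
  module

theorem reflAt_add (he : ‖e‖ = 1) (lam : ℝ) (x z : Rd d) :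
    reflAt e lam (x + z) = reflAt e lam x + (ℝ ∙ e)ᗮ.reflection z := by
  rw [reflAt_eq he, reflAt_eq he, map_add]
  abel

theorem reflAt_add_eq_add (lam : ℝ) (x z : Rd d) :
    reflAt e lam (x + z) = x + reflAt e (lam - ⟪x, e⟫) z := by
  rw [reflAt, reflAt, inner_add_left]
  module

theorem norm_reflAt_sub_sq (he : ‖e‖ = 1) (lam : ℝ) (x y : Rd d) :
    ‖reflAt e lam y - x‖ ^ 2 = ‖y - x‖ ^ 2 + 4 * (⟪y, e⟫ - lam) * (⟪x, e⟫ - lam) := by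
  have h : reflAt e lam y - x = (y - x) - (2 * ⟪y, e⟫ - 2 * lam) • e := by
    rw [reflAt]
    abel
  rw [h, norm_sub_sq_real, norm_smul, he, real_inner_smul_right, inner_sub_left, mul_one,
    Real.norm_eq_abs, sq_abs]
  ring

theorem norm_reflAt_sq (he : ‖e‖ = 1) (lam : ℝ) (y : Rd d) :
    ‖reflAt e lam y‖ ^ 2 = ‖y‖ ^ 2 - 4 * lam * (⟪y, e⟫ - lam) := by
  have h := norm_reflAt_sub_sq he lam 0 y
  rw [sub_zero, sub_zero, inner_zero_left] at h
  rw [h]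
  ring

theorem continuous_reflAt_uncurry (e : Rd d) :
    Continuous fun p : ℝ × Rd d => reflAt e p.1 p.2 := by
  unfold reflAt
  fun_prop

theorem continuous_reflAt (e : Rd d) (lam : ℝ) : Continuous (reflAt e lam) :=
  (continuous_reflAt_uncurry e).comp (by fun_prop : Continuous fun x : Rd d => (lam, x))

theorem measurePreserving_reflAt (he : ‖e‖ = 1) (lam : ℝ) :
    MeasurePreserving (reflAt e lam) volume volume := by
  have h := (measurePreserving_add_right (volume : Measure (Rd d)) ((2 * lam) • e)).comp
    ((ℝ ∙ e)ᗮ.reflection).measurePreserving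
  rwa [show (fun x => x + (2 * lam) • e) ∘ (ℝ ∙ e)ᗮ.reflection = reflAt e lam from
    funext fun x => (reflAt_eq he lam x).symm] at h

theorem measurableEmbedding_reflAt (he : ‖e‖ = 1) (lam : ℝ) :
    MeasurableEmbedding (reflAt e lam) :=
  (MeasurableEquiv.ofInvolutive (reflAt e lam) (reflAt_reflAt he lam)
    (continuous_reflAt e lam).measurable).measurableEmbedding

theorem PsiSetting.ParabolicSuper.comp_reflAt {S : PsiSetting d} (he : ‖e‖ = 1) {lam γ : ℝ}
    {v : Rd d → ℝ} {x : Rd d} (h : S.ParabolicSuper v γ (reflAt e lam x)) :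
    S.ParabolicSuper (fun y => v (reflAt e lam y)) γ x := by
  intro p a s hs hs1 hP
  set T := (ℝ ∙ e)ᗮ.reflection with hT
  have hTT : ∀ z, T (T z) = z := fun z => Submodule.reflection_reflection _ z
  have hadd : ∀ z, reflAt e lam (x + T z) = reflAt e lam x + z := fun z => by
    rw [reflAt_add he, hTT]
  have h1 := h (T p) a s hs hs1 fun z hz => by
    have h2 := hP (T z) (by rwa [T.norm_map])
    simp only [hadd, T.norm_map] at h2
    rwa [← T.inner_map_map, hTT]
  refine h1.trans_eq ?_
  congr 1
  rw [← T.measurePreserving.setIntegral_preimage_emb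
    T.toHomeomorph.measurableEmbedding _ (ball (0 : Rd d) s)ᶜ]
  have hpre : T ⁻¹' (ball (0 : Rd d) s)ᶜ = (ball (0 : Rd d) s)ᶜ := by
    ext z
    simp
  rw [hpre]
  refine integral_congr_ae (ae_of_all _ fun z => ?_)
  simp only [reflAt_add he, hT, LinearIsometryEquiv.norm_map]

theorem PsiSetting.j_reflAt_lt (S : PsiSetting d) (hd : 0 < d) (he : ‖e‖ = 1) {h : ℝ}
    (hh : 0 < h) {z : Rd d} (hz : -h < ⟪z, e⟫) (hz0 : z ≠ 0) :
    S.j ‖reflAt e (-h) z‖ < S.j ‖z‖ := by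
  refine S.j_strictAnti hd (norm_pos_iff.2 hz0)
    (lt_of_pow_lt_pow_left₀ 2 (norm_nonneg _) ?_)
  rw [norm_reflAt_sq he]
  nlinarith [mul_pos hh (by linarith : 0 < ⟪z, e⟫ + h)]

/-- Pairing points with their mirror images in the nonlocal operator applied to an antisymmetric
function at a minimum point over a half-space. -/
theorem PsiSetting.le_of_antisymm (S : PsiSetting d) (hd : 0 < d) (he : ‖e‖ = 1) {h : ℝ}
    (hh : 0 < h) {ω : Rd d → ℝ} (hω : Continuous ω) {M : ℝ} (hM : ∀ z, |ω z| ≤ M)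
    (hanti : ∀ z, ω (reflAt e (-h) z) = -ω z) (hmin : ∀ z, -h < ⟪z, e⟫ → ω 0 ≤ ω z)
    {X ρ₁ ρ₀ : ℝ} (hρ₁ : 0 < ρ₁) (hρ₀ : 0 < ρ₀)
    (hX : ∀ ρ, 0 < ρ → ρ < ρ₁ → X ≤ ∫ z in (ball (0 : Rd d) ρ)ᶜ, (ω 0 - ω z) * S.j ‖z‖) :
    IntegrableOn (fun z => (ball (0 : Rd d) ρ₀)ᶜ.indicator
      (fun z => (ω z - ω 0) * (S.j ‖z‖ - S.j ‖reflAt e (-h) z‖)) z) {z | -h < ⟪z, e⟫} ∧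
    X ≤ 2 * ω 0 * (∫ z in {z : Rd d | ⟪z, e⟫ < -h}, S.j ‖z‖) -
      ∫ z in {z | -h < ⟪z, e⟫}, (ball (0 : Rd d) ρ₀)ᶜ.indicator
        (fun z => (ω z - ω 0) * (S.j ‖z‖ - S.j ‖reflAt e (-h) z‖)) z := by
  set H : Set (Rd d) := {z | -h < ⟪z, e⟫} with hH
  set P : Set (Rd d) := {z | ⟪z, e⟫ < -h} with hP
  set k : Rd d → ℝ := fun z => S.j ‖z‖ with hk
  set k' : Rd d → ℝ := fun z => S.j ‖reflAt e (-h) z‖ with hk'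
  have hin : Measurable fun z : Rd d => ⟪z, e⟫ := by fun_prop
  have hHm : MeasurableSet H := measurableSet_lt measurable_const hin
  have hPm : MeasurableSet P := measurableSet_lt hin measurable_const
  have hkm : Measurable k := S.measurable_j_norm
  have hk'm : Measurable k' := hkm.comp (continuous_reflAt e (-h)).measurable
  have hM0 : 0 ≤ M := (abs_nonneg _).trans (hM 0)
  have hnorm : ∀ z : Rd d, |⟪z, e⟫| ≤ ‖z‖ := fun z => by
    simpa [he] using abs_real_inner_le_norm z e
  have hPn : ∀ z ∈ P, h ≤ ‖z‖ := fun z hz => by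
    have h1 := (abs_le.1 (hnorm z)).1
    have h2 : ⟪z, e⟫ < -h := hz
    linarith
  have hpre : reflAt e (-h) ⁻¹' P = H := by
    ext z
    simp only [mem_preimage, hP, hH, mem_ofPred_eq, inner_reflAt he]
    constructor <;> intro <;> linarith
  have hkP : IntegrableOn k P := S.integrableOn_j_of_ball_subset hPm hh hPn
  have hmp := measurePreserving_reflAt he (-h)
  have hme := measurableEmbedding_reflAt he (-h)
  have hk'H : IntegrableOn k' H := by
    rw [← hpre]
    exact (hmp.integrableOn_comp_preimage hme).2 hkP
  have hk'int : ∫ z in H, k' z = ∫ z in P, k z := by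
    rw [← hpre]
    exact hmp.setIntegral_preimage_emb hme k P
  have hk'b : ∀ z ∈ H, k' z ≤ S.j h := fun z hz => by
    rcases (hPn (reflAt e (-h) z) (by rwa [← mem_preimage, hpre])).eq_or_lt with h1 | h1
    · simp only [hk', ← h1, le_refl]
    · exact (S.j_strictAnti hd hh h1).le
  have hbk' : ∀ F : Rd d → ℝ, Measurable F → ∀ C, (∀ z, |F z| ≤ C) →
      IntegrableOn (fun z => F z * k' z) H := fun F hF C hC =>
    Integrable.bdd_mul (c := C) hk'H hF.aestronglyMeasurable (ae_of_all _ hC)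
  have hd1 : Measurable fun z => ω z - ω 0 := by fun_prop
  have hdb : ∀ z, |ω z - ω 0| ≤ 2 * M := fun z => by
    have h1 := abs_le.1 (hM z)
    have h2 := abs_le.1 (hM 0)
    rw [abs_le]
    constructor <;> linarith
  have hFk : ∀ ρ, 0 < ρ → IntegrableOn
      (fun z => (ball (0 : Rd d) ρ)ᶜ.indicator (fun z => ω z - ω 0) z * k z) H := fun ρ hρ =>
    (S.integrable_compl_ball hd1 hdb hρ).integrableOn
  have hFk' : ∀ ρ, IntegrableOn
      (fun z => (ball (0 : Rd d) ρ)ᶜ.indicator (fun z => ω z - ω 0) z * k' z) H := fun ρ =>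
    hbk' _ (hd1.indicator measurableSet_ball.compl) (2 * M) fun z => by
      by_cases hz : z ∈ (ball (0 : Rd d) ρ)ᶜ
      · rw [indicator_of_mem hz]; exact hdb z
      · rw [indicator_of_notMem hz, abs_zero]; positivity
  have hJ : (fun z => (ball (0 : Rd d) ρ₀)ᶜ.indicator
      (fun z => (ω z - ω 0) * (k z - k' z)) z) = fun z =>
      (ball (0 : Rd d) ρ₀)ᶜ.indicator (fun z => ω z - ω 0) z * k z -
        (ball (0 : Rd d) ρ₀)ᶜ.indicator (fun z => ω z - ω 0) z * k' z := by
    ext z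
    by_cases hz : z ∈ (ball (0 : Rd d) ρ₀)ᶜ <;> simp [hz, mul_sub]
  have hJi : IntegrableOn (fun z => (ball (0 : Rd d) ρ₀)ᶜ.indicator
      (fun z => (ω z - ω 0) * (k z - k' z)) z) H := by
    rw [hJ]
    exact (hFk ρ₀ hρ₀).sub (hFk' ρ₀)
  refine ⟨hJi, ?_⟩
  set J := ∫ z in H, (ball (0 : Rd d) ρ₀)ᶜ.indicator
      (fun z => (ω z - ω 0) * (k z - k' z)) z
  have key : ∀ ρ, 0 < ρ → ρ < min ρ₁ (min ρ₀ h) →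
      X ≤ 2 * ω 0 * (∫ z in P, k z) - J +
        2 * M * S.j h * volume.real (ball (0 : Rd d) ρ) := by
    intro ρ hρ hρm
    have hρ1 : ρ < ρ₁ := hρm.trans_le (min_le_left _ _)
    have hρ0 : ρ < ρ₀ := hρm.trans_le ((min_le_right _ _).trans (min_le_left _ _))
    have hρh : ρ < h := hρm.trans_le ((min_le_right _ _).trans (min_le_right _ _))
    set g : Rd d → ℝ := (ball (0 : Rd d) ρ)ᶜ.indicator fun z => ω z - ω 0 with hg
    have hgi : Integrable fun z => g z * k z := S.integrable_compl_ball hd1 hdb hρ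
    have e0 : ∫ z in (ball (0 : Rd d) ρ)ᶜ, (ω 0 - ω z) * S.j ‖z‖ = -∫ z, g z * k z := by
      rw [hg, integral_indicator_mul measurableSet_ball.compl, ← integral_neg]
      refine integral_congr_ae (ae_of_all _ fun z => ?_)
      simp only [hk]
      ring
    have hHP : (Hᶜ : Set (Rd d)) =ᵐ[volume] P := by
      have h1 : ∀ᵐ z : Rd d, ⟪z, e⟫ ≠ -h := by
        rw [ae_iff]
        simpa using volume_hyperplane he (-h)
      filter_upwards [h1] with z hz
      refine propext ⟨fun h2 => ?_, fun h2 => ?_⟩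
      · exact lt_of_le_of_ne (not_lt.1 h2) hz
      · exact not_lt.2 (le_of_lt h2)
    have e1 : ∫ z, g z * k z = (∫ z in H, g z * k z) + ∫ z in P, g z * k z := by
      rw [← integral_add_compl hHm hgi, setIntegral_congr_set hHP]
    have e2 : ∫ z in P, g z * k z = ∫ z in H, (-ω z - ω 0) * k' z := by
      rw [← hmp.setIntegral_preimage_emb hme _ P, hpre]
      refine setIntegral_congr_fun hHm fun z hz => ?_
      have hzP : reflAt e (-h) z ∈ P := by rwa [← mem_preimage, hpre]
      have hzb : reflAt e (-h) z ∈ (ball (0 : Rd d) ρ)ᶜ := by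
        have := hPn _ hzP
        simp only [mem_compl_iff, mem_ball_zero_iff, not_lt]
        linarith
      simp only [hg, indicator_of_mem hzb, hanti, hk, hk']
    have i1 : IntegrableOn (fun z => (-ω z - ω 0) * k' z) H :=
      hbk' _ (by fun_prop) (2 * M) fun z => by
        have h1 := abs_le.1 (hM z)
        have h2 := abs_le.1 (hM 0)
        rw [abs_le]
        constructor <;> linarith
    have i2 : IntegrableOn ((ball (0 : Rd d) ρ).indicator fun _ => 2 * M * S.j h) H :=
      ((integrable_indicator_iff measurableSet_ball).2
        (integrableOn_const measure_ball_lt_top.ne)).integrableOn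
    have e3 : ∫ z in H, (ball (0 : Rd d) ρ).indicator (fun _ => 2 * M * S.j h) z ≤
        2 * M * S.j h * volume.real (ball (0 : Rd d) ρ) := by
      refine (setIntegral_le_integral ((integrable_indicator_iff measurableSet_ball).2
        (integrableOn_const measure_ball_lt_top.ne)) (ae_of_all _ fun z => ?_)).trans_eq ?_
      · exact indicator_nonneg (fun _ _ => mul_nonneg (by positivity) (S.j_nonneg h)) z
      · rw [integral_indicator measurableSet_ball, setIntegral_const, smul_eq_mul, mul_comm]
    have i3 : IntegrableOn (fun z => 2 * ω 0 * k' z - (ball (0 : Rd d) ρ₀)ᶜ.indicator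
        (fun z => (ω z - ω 0) * (k z - k' z)) z) H := (hk'H.const_mul _).sub hJi
    have e4 : ∫ z in H, (-(g z * k z) - (-ω z - ω 0) * k' z) ≤
        ∫ z in H, (2 * ω 0 * k' z - (ball (0 : Rd d) ρ₀)ᶜ.indicator
          (fun z => (ω z - ω 0) * (k z - k' z)) z +
          (ball (0 : Rd d) ρ).indicator (fun _ => 2 * M * S.j h) z) := by
      refine setIntegral_mono_on (hgi.integrableOn.fun_neg.sub i1)
        (i3.add i2) hHm fun z hz => ?_
      have hω0 : 0 ≤ ω z - ω 0 := sub_nonneg.2 (hmin z hz)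
      have hk'0 : 0 ≤ k' z := S.j_nonneg _
      by_cases hz1 : z ∈ ball (0 : Rd d) ρ
      · have hz2 : z ∉ (ball (0 : Rd d) ρ₀)ᶜ := not_not_intro (ball_subset_ball hρ0.le hz1)
        rw [hg, indicator_of_notMem (not_not_intro hz1), indicator_of_notMem hz2,
          indicator_of_mem hz1]
        have h1 : (ω z - ω 0) * k' z ≤ 2 * M * S.j h :=
          mul_le_mul ((le_abs_self _).trans (hdb z)) (hk'b z hz) hk'0 (by positivity)
        linarith
      · rw [hg, indicator_of_mem hz1, indicator_of_notMem hz1]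
        by_cases hz2 : z ∈ (ball (0 : Rd d) ρ₀)ᶜ
        · rw [indicator_of_mem hz2]
          linarith
        · rw [indicator_of_notMem hz2]
          have hz0 : z ≠ 0 := fun h0 => hz1 (by simpa [h0] using hρ)
          have := mul_nonneg hω0 (sub_nonneg.2 (S.j_reflAt_lt hd he hh hz hz0).le)
          linarith
    rw [integral_sub hgi.integrableOn.fun_neg i1, integral_add i3 i2,
      integral_sub (hk'H.const_mul _) hJi, integral_neg, integral_const_mul, hk'int] at e4
    have := hX ρ hρ hρ1
    linarith
  have hlim : Tendsto (fun ρ => 2 * ω 0 * (∫ z in P, k z) - J +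
      2 * M * S.j h * volume.real (ball (0 : Rd d) ρ)) (𝓝[>] 0)
      (𝓝 (2 * ω 0 * (∫ z in P, k z) - J + 2 * M * S.j h * 0)) := by
    refine (Tendsto.const_mul _ ?_).const_add _
    exact (ENNReal.tendsto_toReal ENNReal.zero_ne_top).comp (tendsto_volume_ball_nhdsGT_zero hd)
  rw [mul_zero, add_zero] at hlim
  refine ge_of_tendsto hlim ?_
  filter_upwards [Ioo_mem_nhdsGT (lt_min hρ₁ (lt_min hρ₀ hh))] with ρ hρ using key ρ hρ.1 hρ.2

end Reflection

section MovingPlanes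

variable {d : ℕ} {S : PsiSetting d} {A L f₀ : ℝ} {f : ℝ → ℝ} {u : Rd d → ℝ} {e : Rd d}

/-- A continuous decaying solution of `Ψ(−Δ)u = f(u)` away from the origin, where it attains its
maximum `A`. -/
structure IsDecayingSolution (S : PsiSetting d) (A L f₀ : ℝ) (f : ℝ → ℝ) (u : Rd d → ℝ) :
    Prop where
  dim_pos : 0 < d
  lip : ∀ s ∈ Icc 0 A, ∀ t ∈ Icc 0 A, |f s - f t| ≤ L * |s - t|
  cont_rhs : ContinuousOn f (Icc 0 A)
  f₀_pos : 0 < f₀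
  f₀_le : f₀ ≤ A
  anti : AntitoneOn f (Icc 0 f₀)
  cont : Continuous u
  mem_Icc : ∀ x, u x ∈ Icc 0 A
  zero : u 0 = A
  decay : Tendsto u (cocompact (Rd d)) (𝓝 0)
  super : ∀ x, x ≠ 0 → S.ParabolicSuper u (f (u x)) x
  sub : ∀ x, x ≠ 0 → S.ParabolicSuper (fun y => -u y) (-f (u x)) x

/-- The values of `u` increase under reflection across the hyperplane `{⟪x, e⟫ = lam}`. -/
def ReflectsUp (e : Rd d) (u : Rd d → ℝ) (lam : ℝ) : Prop :=
  ∀ x, lam < ⟪x, e⟫ → u x ≤ u (reflAt e lam x)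

theorem IsDecayingSolution.abs_le (hs : IsDecayingSolution S A L f₀ f u) (x : Rd d) :
    |u x| ≤ A := by
  rw [abs_of_nonneg (hs.mem_Icc x).1]
  exact (hs.mem_Icc x).2

theorem IsDecayingSolution.exists_bound (hs : IsDecayingSolution S A L f₀ f u) {c : ℝ}
    (hc : 0 < c) : ∃ K, ∀ x, c ≤ u x → ‖x‖ ≤ K := by
  obtain ⟨t, ht, htc⟩ := mem_cocompact.1 (hs.decay.eventually (gt_mem_nhds hc))
  obtain ⟨K, hK⟩ := ht.isBounded.subset_closedBall (0 : Rd d)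
  refine ⟨K, fun x hx => ?_⟩
  by_contra! hcon
  have h1 : x ∈ tᶜ := fun h => not_le.2 hcon (by simpa using hK h)
  exact not_le.2 (htc h1) hx

/-- The integral inequality at a minimum point of `u ∘ R - u` over the half-space. -/
theorem IsDecayingSolution.reflected_inequality (hs : IsDecayingSolution S A L f₀ f u)
    (he : ‖e‖ = 1) {lam : ℝ} {x : Rd d} (hx : lam < ⟪x, e⟫) (hx0 : x ≠ 0)
    (hRx0 : reflAt e lam x ≠ 0)
    (hmin : ∀ y, lam < ⟪y, e⟫ → u (reflAt e lam x) - u x ≤ u (reflAt e lam y) - u y)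
    {ρ₀ : ℝ} (hρ₀ : 0 < ρ₀) :
    IntegrableOn (fun z => (ball (0 : Rd d) ρ₀)ᶜ.indicator
      (fun z => (u (reflAt e lam (x + z)) - u (x + z) - (u (reflAt e lam x) - u x)) *
        (S.j ‖z‖ - S.j ‖reflAt e (-(⟪x, e⟫ - lam)) z‖)) z) {z | -(⟪x, e⟫ - lam) < ⟪z, e⟫} ∧
    f (u (reflAt e lam x)) - f (u x) ≤
      2 * (u (reflAt e lam x) - u x) *
        (∫ z in {z : Rd d | ⟪z, e⟫ < -(⟪x, e⟫ - lam)}, S.j ‖z‖) -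
      ∫ z in {z | -(⟪x, e⟫ - lam) < ⟪z, e⟫}, (ball (0 : Rd d) ρ₀)ᶜ.indicator
        (fun z => (u (reflAt e lam (x + z)) - u (x + z) - (u (reflAt e lam x) - u x)) *
          (S.j ‖z‖ - S.j ‖reflAt e (-(⟪x, e⟫ - lam)) z‖)) z := by
  have huR : Continuous fun y => u (reflAt e lam y) := hs.cont.comp (continuous_reflAt e lam)
  have hfu : Continuous fun y => f (u y) := hs.cont_rhs.comp_continuous hs.cont hs.mem_Icc
  have hfuR : Continuous fun y => f (u (reflAt e lam y)) :=
    hfu.comp (continuous_reflAt e lam)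
  obtain ⟨δ, hδ, hδx⟩ : ∃ δ > 0, ∀ y ∈ closedBall x δ,
      lam < ⟪y, e⟫ ∧ y ≠ 0 ∧ reflAt e lam y ≠ 0 := by
    have h1 : ∀ᶠ y in 𝓝 x, lam < ⟪y, e⟫ :=
      (by fun_prop : Continuous fun y : Rd d => ⟪y, e⟫).continuousAt.eventually
        (lt_mem_nhds hx)
    have h2 : ∀ᶠ y in 𝓝 x, y ≠ 0 := eventually_ne_nhds hx0
    have h3 : ∀ᶠ y in 𝓝 x, reflAt e lam y ≠ 0 :=
      (continuous_reflAt e lam).continuousAt.eventually_ne hRx0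
    exact Metric.nhds_basis_closedBall.eventually_iff.1 (h1.and (h2.and h3))
  have hX : ∀ ρ, 0 < ρ → ρ < δ → f (u (reflAt e lam x)) - f (u x) ≤
      ∫ z in (ball (0 : Rd d) ρ)ᶜ, (u (reflAt e lam (x + 0)) - u (x + 0) -
        (u (reflAt e lam (x + z)) - u (x + z))) * S.j ‖z‖ := by
    intro ρ hρ hρδ
    refine (S.sub_le_at_min hs.dim_pos huR hs.cont (fun y => hs.abs_le _) hs.abs_le
      hfuR.continuousAt hfu.continuousAt
      (fun y hy => (hs.super _ (hδx y hy).2.2).comp_reflAt he)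
      (fun y hy => hs.sub y (hδx y hy).2.1) (fun y hy => hmin y (hδx y hy).1) hρ hρδ).trans_eq ?_
    refine integral_congr_ae (ae_of_all _ fun z => ?_)
    simp only [add_zero]
    ring
  have key := S.le_of_antisymm (ω := fun z => u (reflAt e lam (x + z)) - u (x + z)) (M := 2 * A)
    hs.dim_pos he (sub_pos.2 hx) ?_ (fun z => ?_) (fun z => ?_) (fun z hz => ?_) hδ hρ₀ hX
  · simpa only [add_zero] using key
  · exact (huR.sub hs.cont).comp (continuous_const_add x)
  · have h1 := hs.mem_Icc (reflAt e lam (x + z))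
    have h2 := hs.mem_Icc (x + z)
    rw [_root_.abs_le]
    constructor <;> linarith [h1.1, h1.2, h2.1, h2.2]
  · rw [neg_sub, ← reflAt_add_eq_add, reflAt_reflAt he]
    ring
  · rw [add_zero]
    refine hmin _ ?_
    rw [inner_add_left]
    linarith

theorem PsiSetting.indicator_mul_reflAt_nonneg (S : PsiSetting d) (hd : 0 < d) (he : ‖e‖ = 1)
    {h : ℝ} (hh : 0 < h) {g : Rd d → ℝ} {z : Rd d} (hz : -h < ⟪z, e⟫) (hg : 0 ≤ g z) {ρ₀ : ℝ}
    (hρ₀ : 0 < ρ₀) : 0 ≤ (ball (0 : Rd d) ρ₀)ᶜ.indicator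
      (fun z => g z * (S.j ‖z‖ - S.j ‖reflAt e (-h) z‖)) z := by
  by_cases hz1 : z ∈ (ball (0 : Rd d) ρ₀)ᶜ
  · rw [indicator_of_mem hz1]
    have hz0 : z ≠ 0 := fun h0 => hz1 (by simpa [h0] using hρ₀)
    exact mul_nonneg hg (sub_nonneg.2 (S.j_reflAt_lt hd he hh hz hz0).le)
  · rw [indicator_of_notMem hz1]

theorem PsiSetting.setIntegral_halfSpace_pos (S : PsiSetting d) (hd : 0 < d) (he : ‖e‖ = 1)
    {h : ℝ} (hh : 0 < h) : 0 < ∫ z in {z : Rd d | ⟪z, e⟫ < -h}, S.j ‖z‖ := by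
  have hin : Continuous fun z : Rd d => ⟪z, e⟫ := by fun_prop
  have hP : IsOpen {z : Rd d | ⟪z, e⟫ < -h} := isOpen_lt hin continuous_const
  have hn : ∀ z ∈ {z : Rd d | ⟪z, e⟫ < -h}, h ≤ ‖z‖ := fun z hz => by
    have h1 := abs_real_inner_le_norm z e
    rw [he, mul_one] at h1
    have h2 := (abs_le.1 h1).1
    have h3 : ⟪z, e⟫ < -h := hz
    linarith
  rw [setIntegral_pos_iff_support_of_nonneg_ae (ae_of_all _ fun z => S.j_nonneg _)
    (S.integrableOn_j_of_ball_subset hP.measurableSet hh hn)]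
  refine (hP.measure_pos volume ⟨-(h + 1) • e, ?_⟩).trans_le
    (measure_mono fun z hz => ⟨?_, hz⟩)
  · rw [mem_ofPred_eq, real_inner_smul_left, real_inner_self_eq_norm_sq, he]
    linarith
  · exact (S.j_pos hd (hh.trans_le (hn z hz))).ne'

theorem IsDecayingSolution.exists_far_of_not_reflectsUp (hs : IsDecayingSolution S A L f₀ f u)
    (he : ‖e‖ = 1) : ∃ δ > 0, ∀ lam, 0 < lam → ¬ReflectsUp e u lam →
      ∃ x, lam + δ < ⟪x, e⟫ ∧ f₀ < u x ∧ u (reflAt e lam x) < u x := by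
  obtain ⟨δ, hδ, hδL⟩ := S.exists_lt_setIntegral_halfSpace hs.dim_pos he L
  refine ⟨δ, hδ, fun lam hlam hnot => ?_⟩
  rw [ReflectsUp] at hnot
  push Not at hnot
  obtain ⟨y₀, hy₀, hwy₀⟩ := hnot
  set w : Rd d → ℝ := fun y => u (reflAt e lam y) - u y with hw
  have hwc : Continuous w := (hs.cont.comp (continuous_reflAt e lam)).sub hs.cont
  have hc : w y₀ < 0 := sub_neg.2 hwy₀
  obtain ⟨K, hK⟩ := hs.exists_bound (neg_pos.2 hc)
  have hin : Continuous fun z : Rd d => ⟪z, e⟫ := by fun_prop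
  have hfar : ∀ y, w y ≤ w y₀ → ‖y‖ ≤ K := fun y hy => hK y (by
    have h1 := (hs.mem_Icc (reflAt e lam y)).1
    have h2 : w y = u (reflAt e lam y) - u y := rfl
    linarith)
  obtain ⟨x, ⟨hxK, hxH⟩, hxmin⟩ := ((isCompact_closedBall (0 : Rd d) K).inter_right
    (isClosed_le continuous_const hin : IsClosed {y : Rd d | lam ≤ ⟪y, e⟫})).exists_isMinOn
    ⟨y₀, by simpa using hfar y₀ le_rfl, hy₀.le⟩ hwc.continuousOn
  have hxy₀ : w x ≤ w y₀ := hxmin ⟨by simpa using hfar y₀ le_rfl, hy₀.le⟩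
  have hmin : ∀ y, lam < ⟪y, e⟫ → w x ≤ w y := fun y hy => by
    rcases le_or_gt (w y) (w y₀) with h1 | h1
    · exact hxmin ⟨by simpa using hfar y h1, hy.le⟩
    · exact hxy₀.trans h1.le
  have hwx : w x < 0 := hxy₀.trans_lt hc
  have hux : u (reflAt e lam x) < u x := sub_neg.1 hwx
  have hxH' : lam < ⟪x, e⟫ := by
    refine lt_of_le_of_ne hxH fun heq => hux.ne ?_
    rw [reflAt, ← heq, sub_self, zero_smul, sub_zero]
  have hx0 : x ≠ 0 := by
    rintro rfl
    rw [inner_zero_left] at hxH'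
    exact lt_asymm hlam hxH'
  have hRx0 : reflAt e lam x ≠ 0 := fun h0 => by
    rw [h0, hs.zero] at hux
    exact not_le.2 hux (hs.mem_Icc x).2
  have hh := sub_pos.2 hxH'
  obtain ⟨-, key⟩ := hs.reflected_inequality he hxH' hx0 hRx0 hmin one_pos
  set ν := ∫ z in {z : Rd d | ⟪z, e⟫ < -(⟪x, e⟫ - lam)}, S.j ‖z‖ with hν
  have hν0 : 0 < ν := S.setIntegral_halfSpace_pos hs.dim_pos he hh
  have hI : f (u (reflAt e lam x)) - f (u x) ≤ 2 * w x * ν := by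
    refine key.trans (sub_le_self _ (setIntegral_nonneg
      (measurableSet_lt measurable_const hin.measurable) fun z hz => ?_))
    refine S.indicator_mul_reflAt_nonneg hs.dim_pos he hh hz (sub_nonneg.2 ?_) one_pos
    refine hmin _ ?_
    have hz' : -(⟪x, e⟫ - lam) < ⟪z, e⟫ := hz
    rw [inner_add_left]
    linarith
  have hlt : f₀ < u x := by
    by_contra! hle
    have h1 := hs.anti ⟨(hs.mem_Icc _).1, hux.le.trans hle⟩ ⟨(hs.mem_Icc _).1, hle⟩ hux.le
    nlinarith [mul_pos (neg_pos.2 hwx) hν0]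
  refine ⟨x, ?_, hlt, hux⟩
  by_contra! hle
  have h1 := hδL _ hh (by linarith)
  have h2 := (_root_.abs_le.1 (hs.lip _ (hs.mem_Icc (reflAt e lam x)) _ (hs.mem_Icc x))).1
  rw [abs_of_neg hwx] at h2
  have h3 : 0 < -w x * (2 * ν - L) := mul_pos (neg_pos.2 hwx) (by linarith)
  nlinarith

/-- The strong maximum principle for the antisymmetric function `u ∘ R - u`. -/
theorem IsDecayingSolution.lt_reflAt (hs : IsDecayingSolution S A L f₀ f u) (he : ‖e‖ = 1)
    {lam : ℝ} (hlam : 0 < lam) (hup : ReflectsUp e u lam) {y : Rd d} (hy : lam < ⟪y, e⟫)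
    (huy : u y < u (reflAt e lam y)) {x : Rd d} (hx : lam < ⟪x, e⟫)
    (hRx0 : reflAt e lam x ≠ 0) : u x < u (reflAt e lam x) := by
  refine lt_of_le_of_ne (hup x hx) fun heq => ?_
  have hxy : y - x ≠ 0 := sub_ne_zero.2 fun h => huy.ne (h ▸ heq)
  have hx0 : x ≠ 0 := by
    rintro rfl
    rw [inner_zero_left] at hx
    exact lt_asymm hlam hx
  have hh := sub_pos.2 hx
  have hin : Continuous fun z : Rd d => ⟪z, e⟫ := by fun_prop
  have hρ : 0 < ‖y - x‖ / 2 := by positivity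
  obtain ⟨hint, key⟩ := hs.reflected_inequality he hx hx0 hRx0
    (fun z hz => by rw [← heq, sub_self]; exact sub_nonneg.2 (hup z hz)) hρ
  simp only [← heq, sub_self, mul_zero, zero_mul, sub_zero, zero_sub] at hint key
  have hHm : MeasurableSet {z : Rd d | -(⟪x, e⟫ - lam) < ⟪z, e⟫} :=
    measurableSet_lt measurable_const hin.measurable
  have hmem : ∀ z, -(⟪x, e⟫ - lam) < ⟪z, e⟫ → lam < ⟪x + z, e⟫ := fun z hz => by
    rw [inner_add_left]
    linarith
  have hnn : 0 ≤ᵐ[volume.restrict {z : Rd d | -(⟪x, e⟫ - lam) < ⟪z, e⟫}]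
      fun z => (ball (0 : Rd d) (‖y - x‖ / 2))ᶜ.indicator
        (fun z => (u (reflAt e lam (x + z)) - u (x + z)) *
          (S.j ‖z‖ - S.j ‖reflAt e (-(⟪x, e⟫ - lam)) z‖)) z := by
    filter_upwards [ae_restrict_mem hHm] with z hz
    exact S.indicator_mul_reflAt_nonneg hs.dim_pos he hh hz
      (sub_nonneg.2 (hup _ (hmem z hz))) hρ
  refine not_lt.2 (neg_nonneg.1 key) ((setIntegral_pos_iff_support_of_nonneg_ae hnn hint).2 ?_)
  set V : Set (Rd d) := {z | -(⟪x, e⟫ - lam) < ⟪z, e⟫} ∩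
    ({z | ‖y - x‖ / 2 < ‖z‖} ∩ {z | u (x + z) < u (reflAt e lam (x + z))}) with hV
  have hVo : IsOpen V := by
    refine (isOpen_lt continuous_const hin).inter ((isOpen_lt continuous_const
      continuous_norm).inter (isOpen_lt (hs.cont.comp (continuous_const_add x)) ?_))
    exact (hs.cont.comp (continuous_reflAt e lam)).comp (continuous_const_add x)
  refine (hVo.measure_pos volume ⟨y - x, ?_, ?_, ?_⟩).trans_le
    (measure_mono fun z hz => ⟨?_, hz.1⟩)
  · rw [mem_ofPred_eq, inner_sub_left]
    linarith
  · exact half_lt_self (norm_pos_iff.2 hxy)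
  · rwa [mem_ofPred_eq, add_sub_cancel]
  · have h1 : ‖y - x‖ / 2 < ‖z‖ := hz.2.1
    have h2 : z ∈ (ball (0 : Rd d) (‖y - x‖ / 2))ᶜ := fun h =>
      lt_asymm h1 (mem_ball_zero_iff.1 h)
    rw [Function.mem_support, indicator_of_mem h2]
    exact mul_ne_zero (sub_pos.2 hz.2.2).ne'
      (sub_pos.2 (S.j_reflAt_lt hs.dim_pos he hh hz.1 (norm_pos_iff.1 (hρ.trans h1)))).ne'

theorem IsDecayingSolution.lt_reflAt_of_forall_lt (hs : IsDecayingSolution S A L f₀ f u)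
    (he : ‖e‖ = 1) {lam : ℝ} (hlam : 0 < lam) (hup : ReflectsUp e u lam)
    (hmax : ∀ x, u x = A → ⟪x, e⟫ < 2 * lam) {x : Rd d} (hx : lam < ⟪x, e⟫) :
    u x < u (reflAt e lam x) := by
  have key : ∀ y, lam < ⟪y, e⟫ → reflAt e lam y = 0 → u y < u (reflAt e lam y) := by
    intro y hy h0
    rw [h0, hs.zero]
    refine lt_of_le_of_ne (hs.mem_Icc y).2 fun hA => (hmax y hA).ne ?_
    have h1 := inner_reflAt he lam y
    rw [h0, inner_zero_left] at h1
    linarith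
  by_cases hRx : reflAt e lam x = 0
  · exact key x hx hRx
  · refine hs.lt_reflAt he hlam hup (y := reflAt e lam 0) ?_ (key _ ?_ (reflAt_reflAt he lam 0))
      hx hRx <;>
    · rw [inner_reflAt he, inner_zero_left]
      linarith

/-- Moving the plane down to half of the height of the set where `u` is maximal. -/
theorem IsDecayingSolution.reflectsUp_of_forall_le (hs : IsDecayingSolution S A L f₀ f u)
    (he : ‖e‖ = 1) {M : ℝ} (hM : ∀ x, u x = A → ⟪x, e⟫ ≤ M) {lam : ℝ} (hlam : 0 < lam)
    (hlamM : M < 2 * lam) : ReflectsUp e u lam := by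
  by_contra hbad
  obtain ⟨δ, hδ, hfar⟩ := hs.exists_far_of_not_reflectsUp he
  obtain ⟨K, hK⟩ := hs.exists_bound hs.f₀_pos
  have hle : ∀ x : Rd d, ⟪x, e⟫ ≤ ‖x‖ := fun x => by
    simpa [he] using real_inner_le_norm x e
  have hin : Continuous fun z : Rd d => ⟪z, e⟫ := by fun_prop
  set T : Set ℝ := {t | lam ≤ t ∧ ¬ReflectsUp e u t} with hT
  have hTne : T.Nonempty := ⟨lam, le_rfl, hbad⟩
  have hTb : BddAbove T := ⟨K, fun t ht => by
    obtain ⟨x, hx1, hx2, -⟩ := hfar t (hlam.trans_le ht.1) ht.2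
    linarith [hle x, hK x hx2.le]⟩
  set l := sSup T with hl
  have hlaml : lam ≤ l := le_csSup hTb ⟨le_rfl, hbad⟩
  have hup : ReflectsUp e u l := by
    intro x hx
    have hc : Tendsto (fun t => u (reflAt e t x)) (𝓝[>] l) (𝓝 (u (reflAt e l x))) :=
      ((hs.cont.comp ((continuous_reflAt_uncurry e).comp
        (by fun_prop : Continuous fun t : ℝ => (t, x)))).tendsto l).mono_left nhdsWithin_le_nhds
    refine ge_of_tendsto hc ?_
    filter_upwards [Ioo_mem_nhdsGT hx] with t ht
    have hgood : ReflectsUp e u t := by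
      by_contra h
      exact not_le.2 ht.1 (le_csSup hTb ⟨hlaml.trans ht.1.le, h⟩)
    exact hgood x ht.2
  have hC : IsCompact (closedBall (0 : Rd d) K ∩ {x | l + δ / 2 ≤ ⟪x, e⟫}) :=
    (isCompact_closedBall _ _).inter_right (isClosed_le continuous_const hin)
  have hev : ∀ᶠ t in 𝓝 l, ∀ x ∈ closedBall (0 : Rd d) K ∩ {x | l + δ / 2 ≤ ⟪x, e⟫},
      u x < u (reflAt e t x) := by
    refine hC.eventually_forall_of_forall_eventually fun x hx => ?_
    have hx2 : l + δ / 2 ≤ ⟪x, e⟫ := hx.2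
    have hlt := hs.lt_reflAt_of_forall_lt he (hlam.trans_le hlaml) hup
      (fun y hy => (hM y hy).trans_lt (by linarith)) (x := x) (by linarith)
    exact (isOpen_lt (hs.cont.comp continuous_snd)
      (hs.cont.comp (continuous_reflAt_uncurry e))).mem_nhds hlt
  obtain ⟨t, ht, htT⟩ := (mem_closure_iff_nhds.1 (csSup_mem_closure hTne hTb) _
    (hev.and (lt_mem_nhds (by linarith : l - δ / 2 < l))))
  obtain ⟨x, hx1, hx2, hx3⟩ := hfar t (hlam.trans_le htT.1) htT.2
  have ht2 := ht.2
  refine lt_asymm hx3 (ht.1 x ⟨by simpa using hK x hx2.le, ?_⟩)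
  rw [mem_ofPred_eq]
  linarith

theorem IsDecayingSolution.inner_nonpos (hs : IsDecayingSolution S A L f₀ f u)
    (he : ‖e‖ = 1) {x : Rd d} (hx : u x = A) : ⟪x, e⟫ ≤ 0 := by
  obtain ⟨K, hK⟩ := hs.exists_bound (hs.f₀_pos.trans_le hs.f₀_le)
  have hin : Continuous fun z : Rd d => ⟪z, e⟫ := by fun_prop
  obtain ⟨z, ⟨-, hzA⟩, hz⟩ := ((isCompact_closedBall (0 : Rd d) K).inter_right
    (isClosed_singleton.preimage hs.cont : IsClosed (u ⁻¹' {A}))).exists_isMaxOn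
    ⟨x, by simpa using hK x hx.ge, hx⟩ hin.continuousOn
  have hM : ∀ y, u y = A → ⟪y, e⟫ ≤ ⟪z, e⟫ := fun y hy =>
    hz ⟨by simpa using hK y hy.ge, hy⟩
  refine (hM x hx).trans ?_
  by_contra! hpos
  have h1 : ⟪z, e⟫ < 2 * (3 / 4 * ⟪z, e⟫) := by linarith
  have hup := hs.reflectsUp_of_forall_le he hM (by positivity : 0 < 3 / 4 * ⟪z, e⟫) h1
  have h2 := hs.lt_reflAt_of_forall_lt he (by positivity) hup
    (fun y hy => (hM y hy).trans_lt h1) (x := z) (by linarith)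
  rw [show u z = A from hzA] at h2
  exact not_le.2 h2 (hs.mem_Icc _).2

theorem IsDecayingSolution.reflectsUp (hs : IsDecayingSolution S A L f₀ f u) (he : ‖e‖ = 1)
    {lam : ℝ} (hlam : 0 < lam) : ReflectsUp e u lam :=
  hs.reflectsUp_of_forall_le he (fun _ hx => hs.inner_nonpos he hx) hlam (by positivity)

theorem IsDecayingSolution.le_reflAt_zero (hs : IsDecayingSolution S A L f₀ f u) (he : ‖e‖ = 1)
    {x : Rd d} (hx : 0 < ⟪x, e⟫) : u x ≤ u (reflAt e 0 x) := by
  have hc : Tendsto (fun t => u (reflAt e t x)) (𝓝[>] 0) (𝓝 (u (reflAt e 0 x))) :=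
    ((hs.cont.comp ((continuous_reflAt_uncurry e).comp
      (by fun_prop : Continuous fun t : ℝ => (t, x)))).tendsto 0).mono_left nhdsWithin_le_nhds
  refine ge_of_tendsto hc ?_
  filter_upwards [Ioo_mem_nhdsGT hx] with t ht using hs.reflectsUp he ht.1 x ht.2

theorem IsDecayingSolution.le_of_norm_eq (hs : IsDecayingSolution S A L f₀ f u) {x y : Rd d}
    (hxy : ‖x‖ = ‖y‖) : u x ≤ u y := by
  rcases eq_or_ne x y with rfl | hne
  · exact le_rfl
  have hn : 0 < ‖x - y‖ := norm_pos_iff.2 (sub_ne_zero.2 hne)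
  set e : Rd d := ‖x - y‖⁻¹ • (x - y) with he
  have he1 : ‖e‖ = 1 := norm_smul_inv_norm (𝕜 := ℝ) (sub_ne_zero.2 hne)
  have h2 : ‖x - y‖ ^ 2 = 2 * ⟪x, x - y⟫ := by
    rw [norm_sub_sq_real, inner_sub_right, real_inner_self_eq_norm_sq, hxy]
    ring
  have hin : ⟪x, e⟫ = ‖x - y‖ / 2 := by
    rw [he, real_inner_smul_right]
    field_simp
    linarith
  have hR : reflAt e 0 x = y := by
    rw [reflAt, hin, he, smul_smul, show (2 * (‖x - y‖ / 2) - 2 * 0) * ‖x - y‖⁻¹ = 1 by field_simp; ring]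
    module
  have := hs.le_reflAt_zero he1 (x := x) (by rw [hin]; positivity)
  rwa [hR] at this

theorem IsDecayingSolution.lt_of_norm_lt (hs : IsDecayingSolution S A L f₀ f u) {x y : Rd d}
    (hxy : ‖x‖ < ‖y‖) : u y < u x := by
  have hy : 0 < ‖y‖ := (norm_nonneg x).trans_lt hxy
  have hx := norm_nonneg x
  set e : Rd d := ‖y‖⁻¹ • y with he
  have he1 : ‖e‖ = 1 := norm_smul_inv_norm (𝕜 := ℝ) (norm_pos_iff.1 hy)
  have hye : y = ‖y‖ • e := by rw [he, smul_inv_smul₀ hy.ne']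
  have hin : ⟪y, e⟫ = ‖y‖ := by
    rw [he, real_inner_smul_right, real_inner_self_eq_norm_sq]
    field_simp
  have hlam : 0 < (‖x‖ + ‖y‖) / 2 := by positivity
  have hR : reflAt e ((‖x‖ + ‖y‖) / 2) y = ‖x‖ • e := by
    rw [reflAt, hin]
    nth_rewrite 1 [hye]
    module
  have h1 := hs.lt_reflAt_of_forall_lt he1 hlam (hs.reflectsUp he1 hlam)
    (fun z hz => (hs.inner_nonpos he1 hz).trans_lt (by positivity)) (x := y)
    (by rw [hin]; linarith)
  rw [hR] at h1
  refine h1.trans_le (hs.le_of_norm_eq ?_)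
  rw [norm_smul, he1, norm_norm, mul_one]

end MovingPlanes

/-- **Theorem 2.4**: any continuous solution of `Ψ(−Δ)u = f(u)` in `ℝ^d∖{0}`
with `u(0) = A = max u`, `0 ≤ u ≤ A`, decaying at infinity, where `f` is
Lipschitz on `[0,A]` and non-increasing near `0`, is radially symmetric and
strictly decreasing in the radial direction. -/
theorem radial_symmetry_punctured
    {d : ℕ} (hd : 2 ≤ d) (S : PsiSetting d) (hker : S.kernelCond)
    (A : ℝ) (hA : 0 < A)
    (f : ℝ → ℝ) (hf : ∃ L : ℝ≥0, LipschitzOnWith L f (Set.Icc 0 A))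
    (f₀ : ℝ) (hf₀ : 0 < f₀ ∧ f₀ ≤ A) (hmono : AntitoneOn f (Set.Icc 0 f₀))
    (u : Rd d → ℝ) (hu : Continuous u)
    (hsol : IsSol S ({(0 : Rd d)}ᶜ) (fun _ => 0) (fun x => f (u x)) u)
    (h0 : u 0 = A) (hbound : ∀ x, 0 ≤ u x ∧ u x ≤ A)
    (hdecay : Filter.Tendsto u (Filter.cocompact (Rd d)) (nhds 0)) :
    (∀ x y : Rd d, ‖x‖ = ‖y‖ → u x = u y) ∧
      (∀ x y : Rd d, ‖x‖ < ‖y‖ → u y < u x) := by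
  obtain ⟨L, hL⟩ := hf
  have hub : ∀ x, |u x| ≤ A := fun x => by
    rw [abs_of_nonneg (hbound x).1]
    exact (hbound x).2
  have hs : IsDecayingSolution S A L f₀ f u :=
    { dim_pos := by omega
      lip := fun s hs t ht => by simpa [Real.dist_eq] using hL.dist_le_mul s hs t ht
      cont_rhs := hL.continuousOn
      f₀_pos := hf₀.1
      f₀_le := hf₀.2
      anti := hmono
      cont := hu
      mem_Icc := hbound
      zero := h0
      decay := hdecay
      super := fun x hx => S.parabolicSuper_of_test hu hub fun φ hφ hφx hφu => by
        simpa using hsol.2.2 x hx φ hφ hφx hφu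
      sub := fun x hx => by
        refine S.parabolicSuper_of_test hu.fun_neg (fun y => by simpa using hub y)
          fun φ hφ hφx hφu => ?_
        have := hsol.1.2 x hx (fun y => -φ y) hφ.neg (by simp [hφx])
          fun y hy => lt_neg_of_lt_neg (hφu y hy)
        rw [psiOp_neg, zero_mul, add_zero] at this
        linarith }
  exact ⟨fun x y hxy => (hs.le_of_norm_eq hxy).antisymm (hs.le_of_norm_eq hxy.symm),
    fun x y hxy => hs.lt_of_norm_lt hxy⟩
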